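/- arXiv:1512.03446 — 2 statements merged into one kernel-verified Lean document; each statement's English description precedes it below -/
import Mathlib

section
/- Let q be a prime power, β a composition of N with ℓ parts, and P a normal subposet of the chain on {1,…,ℓ}. Let λ ∈ T_P^β and let Λ be a partial permutation matrix in 𝔲𝔱_{fat_β(P)} with block-rank vector λ. Then |O(Λ)| = q^{dim_L(λ) + dim_R(λ) − crs(λ)} · ∏_{(j,l) : j P l} |GL_{λ(j,l)}(𝔽_q)| · [β_j − Σ_{m > l} λ(j,m) choose λ(j,l)]_q · [β_l − Σ_{i < j} λ(i,l) choose λ(j,l)]_q (sums over pairs in the domain of λ). In particular this is the degree χ^Λ(1) of the supercharacter labelled by λ. -/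
open scoped Classical

noncomputable section

/-- A subposet of the chain `0 < 1 < ⋯ < l-1`: a transitive relation contained in `<`. -/
def IsChainSubposet {l : ℕ} (P : Fin l → Fin l → Prop) : Prop :=
  (∀ i j k, P i j → P j k → P i k) ∧ ∀ i j, P i j → i < j

/-- A normal subposet of the chain. -/
def IsNormalChainSubposet {l : ℕ} (P : Fin l → Fin l → Prop) : Prop :=
  IsChainSubposet P ∧ (∀ i j k, P j k → i < j → P i k) ∧ ∀ j k m, P j k → k < m → P j m

/-- The relation `fat_β(P)` on `Fin N` obtained from a relation `P` on block indices. -/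
def fatR {N l : ℕ} (blk : Fin N → Fin l) (P : Fin l → Fin l → Prop) :
    Fin N → Fin N → Prop := fun r s => P (blk r) (blk s)

/-- The "pattern group" of a relation: unipotent matrices supported on the relation. -/
def UTgrp (F : Type) [Field F] {N : ℕ} (R : Fin N → Fin N → Prop) :
    Set (Matrix (Fin N) (Fin N) F) :=
  {g | (∀ r, g r r = 1) ∧ ∀ r s, r ≠ s → ¬ R r s → g r s = 0}

/-- The nilpotent "pattern algebra" of a relation. -/
def utAlg (F : Type) [Field F] {N : ℕ} (R : Fin N → Fin N → Prop) :
    Set (Matrix (Fin N) (Fin N) F) :=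
  {x | ∀ r s, ¬ R r s → x r s = 0}

/-- The parabolic subgroup `P_β`: invertible block upper-triangular matrices. -/
def parab (F : Type) [Field F] {N l : ℕ} (blk : Fin N → Fin l) :
    Set (Matrix (Fin N) (Fin N) F) :=
  {g | IsUnit g ∧ ∀ r s, ¬ blk r ≤ blk s → g r s = 0}

/-- The Levi subgroup `L_β`: invertible block diagonal matrices. -/
def levi (F : Type) [Field F] {N l : ℕ} (blk : Fin N → Fin l) :
    Set (Matrix (Fin N) (Fin N) F) :=
  {g | IsUnit g ∧ ∀ r s, blk r ≠ blk s → g r s = 0}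

/-- The opposite unipotent radical `U⁻_β`: block lower uni-triangular matrices. -/
def uminus (F : Type) [Field F] {N l : ℕ} (blk : Fin N → Fin l) :
    Set (Matrix (Fin N) (Fin N) F) :=
  {g | (∀ r, g r r = 1) ∧ ∀ r s, r ≠ s → ¬ blk s < blk r → g r s = 0}

/-- Truncation of a matrix to the positions of a relation. -/
def trunc {F : Type} [Field F] {N : ℕ} (R : Fin N → Fin N → Prop)
    (x : Matrix (Fin N) (Fin N) F) : Matrix (Fin N) (Fin N) F :=
  fun r s => if R r s then x r s else 0

/-- The two-sided orbit `O(Y)` of `Y` under the block lower-triangular invertible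
matrices, truncated back to the positions of `R`. -/
def orb (F : Type) [Field F] {N l : ℕ} (blk : Fin N → Fin l) (R : Fin N → Fin N → Prop)
    (Y : Matrix (Fin N) (Fin N) F) : Set (Matrix (Fin N) (Fin N) F) :=
  {Z | ∃ g h : Matrix (Fin N) (Fin N) F, IsUnit g ∧ IsUnit h ∧
      (∀ r s, blk r < blk s → g r s = 0) ∧ (∀ r s, blk r < blk s → h r s = 0) ∧
      Z = trunc R (g * Y * h)}

/-- The supercharacter `χ^Y` as a function on matrices. -/
def chi {F : Type} [Field F] [Fintype F] (ψ : F → ℂ) {N l : ℕ} (blk : Fin N → Fin l)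
    (R : Fin N → Fin N → Prop) (Y u : Matrix (Fin N) (Fin N) F) : ℂ :=
  ∑ᶠ Z ∈ orb F blk R Y, ψ (∑ r, ∑ s, Z r s * (u - 1) r s)

/-- A partial permutation matrix: 0-1 entries, at most one 1 in each row and column. -/
def IsPPM {F : Type} [Field F] {N : ℕ} (x : Matrix (Fin N) (Fin N) F) : Prop :=
  (∀ r s, x r s = 0 ∨ x r s = 1) ∧
  (∀ r s t, x r s ≠ 0 → x r t ≠ 0 → s = t) ∧
  (∀ r s t, x r t ≠ 0 → x s t ≠ 0 → r = s)

/-- The rank of the block of `x` with rows in block `i` and columns in block `j`. -/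
def blockRank {F : Type} [Field F] {N l : ℕ} (blk : Fin N → Fin l)
    (x : Matrix (Fin N) (Fin N) F) (i j : Fin l) : ℕ :=
  (x.submatrix (fun r : {r : Fin N // blk r = i} => (r : Fin N))
    (fun s : {s : Fin N // blk s = j} => (s : Fin N))).rank

end

noncomputable section

/-- `λ ∈ T_P^β`: `λ` is supported on `P` and has row and column sums bounded by `β`. -/
def Tmem {l : ℕ} (P : Fin l → Fin l → Prop) (β : Fin l → ℕ)
    (lam : Fin l → Fin l → ℕ) : Prop :=
  (∀ i j, ¬ P i j → lam i j = 0) ∧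
  ∀ j, (∑ i ∈ Finset.univ.filter (fun i => P i j), lam i j) ≤ β j ∧
    (∑ k ∈ Finset.univ.filter (fun k => P j k), lam j k) ≤ β j

/-- `dim_L(λ) = Σ_{i P j, j < k, i P k} λ(i,k)·β_j`. -/
def bDimL {l : ℕ} (P : Fin l → Fin l → Prop) (β : Fin l → ℕ)
    (lam : Fin l → Fin l → ℕ) : ℕ :=
  ∑ t ∈ Finset.univ.filter (fun t : Fin l × Fin l × Fin l =>
      P t.1 t.2.1 ∧ t.2.1 < t.2.2 ∧ P t.1 t.2.2),
    lam t.1 t.2.2 * β t.2.1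

/-- `dim_R(λ) = Σ_{i < j, j P k, i P k} λ(i,k)·β_j`. -/
def bDimR {l : ℕ} (P : Fin l → Fin l → Prop) (β : Fin l → ℕ)
    (lam : Fin l → Fin l → ℕ) : ℕ :=
  ∑ t ∈ Finset.univ.filter (fun t : Fin l × Fin l × Fin l =>
      t.1 < t.2.1 ∧ P t.2.1 t.2.2 ∧ P t.1 t.2.2),
    lam t.1 t.2.2 * β t.2.1

/-- `crs(λ) = Σ_{i < j, j P k, k < l, i P k, j P l} λ(i,k)·λ(j,l)`. -/
def bCrs {l : ℕ} (P : Fin l → Fin l → Prop) (lam : Fin l → Fin l → ℕ) : ℕ :=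
  ∑ t ∈ Finset.univ.filter (fun t : Fin l × Fin l × Fin l × Fin l =>
      t.1 < t.2.1 ∧ P t.2.1 t.2.2.1 ∧ t.2.2.1 < t.2.2.2 ∧
      P t.1 t.2.2.1 ∧ P t.2.1 t.2.2.2),
    lam t.1 t.2.2.1 * lam t.2.1 t.2.2.2

/-- `|GL_r(𝔽_q)| = ∏_{i=0}^{r−1}(q^r − q^i)`. -/
def GLcard (F : Type) [Field F] [Fintype F] (r : ℕ) : ℕ :=
  ∏ i ∈ Finset.range r, (Fintype.card F ^ r - Fintype.card F ^ i)

def WrecB (q n : ℕ) : ℕ → ℕ → ℕ → ℕ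
  | 0, c, e => if c = e then 1 else 0
  | m + 1, c, e => q ^ c * WrecB q n m c e + (q ^ n - q ^ c) * WrecB q n m (c + 1) e

lemma WrecB_zero (q n : ℕ) : ∀ (m c e : ℕ), e < c → WrecB q n m c e = 0 := by
  intro m
  induction m with
  | zero => intro c e h; simp [WrecB]; omega
  | succ m ih =>
    intro c e h
    simp [WrecB, ih c e h, ih (c+1) e (by omega)]

def Dq (q k : ℕ) : ℂ := ∏ i ∈ Finset.range k, ((q : ℂ) ^ (i + 1) - 1)

lemma Dq_succ (q k : ℕ) : Dq q (k+1) = Dq q k * ((q : ℂ) ^ (k + 1) - 1) := by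
  simp [Dq, Finset.prod_range_succ]

lemma qpow_sub_ne (q : ℕ) (hq : 2 ≤ q) (k : ℕ) : ((q : ℂ) ^ (k + 1) - 1) ≠ 0 := by
  have : 1 < q ^ (k+1) := Nat.one_lt_pow (by omega) (by omega)
  intro h
  have h2 : ((q ^ (k+1) : ℕ) : ℂ) = ((1 : ℕ) : ℂ) := by push_cast; linear_combination h
  have := Nat.cast_injective h2
  omega

lemma Dq_ne (q : ℕ) (hq : 2 ≤ q) (k : ℕ) : Dq q k ≠ 0 := by
  unfold Dq
  exact Finset.prod_ne_zero_iff.2 (fun i _ => qpow_sub_ne q hq i)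

lemma Dq_add (q a k : ℕ) : Dq q (a + k) =
    Dq q a * ∏ i ∈ Finset.range k, ((q : ℂ) ^ (a + i + 1) - 1) := by
  induction k with
  | zero => simp
  | succ k ih => rw [← add_assoc, Dq_succ, ih, Finset.prod_range_succ]; ring

lemma G_eq (q : ℕ) (hq : 2 ≤ q) (G : ℕ → ℕ → ℕ)
    (hG1 : ∀ a k, k ≤ a →
      G a k * ∏ i ∈ Finset.range k, (q ^ (i + 1) - 1) =
        ∏ i ∈ Finset.range k, (q ^ (a - k + i + 1) - 1)) (a k : ℕ) (h : k ≤ a) :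
    (G a k : ℂ) * Dq q k * Dq q (a - k) = Dq q a := by
  have h1 := congrArg (Nat.cast : ℕ → ℂ) (hG1 a k h)
  have hp : ∀ n, 1 ≤ q ^ n := fun n => Nat.one_le_pow _ _ (by omega)
  push_cast [Nat.cast_sub (hp _)] at h1
  have h2 := Dq_add q (a-k) k
  rw [Nat.sub_add_cancel h, ← h1] at h2
  rw [h2]; unfold Dq; ring

lemma G_pascal (q : ℕ) (hq : 2 ≤ q) (G : ℕ → ℕ → ℕ)
    (hG1 : ∀ a k, k ≤ a →
      G a k * ∏ i ∈ Finset.range k, (q ^ (i + 1) - 1) =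
        ∏ i ∈ Finset.range k, (q ^ (a - k + i + 1) - 1))
    (hG2 : ∀ a k, a < k → G a k = 0) (m r : ℕ) (h : r ≤ m) :
    (G (m+1) (r+1) : ℂ) = G m (r+1) + (q : ℂ) ^ (m - r) * G m r := by
  have e1 := G_eq q hq G hG1 (m+1) (r+1) (by omega)
  have e2 := G_eq q hq G hG1 m r h
  have n1 := Dq_ne q hq
  have n2 := qpow_sub_ne q hq
  rw [Nat.add_sub_add_right, Dq_succ, Dq_succ] at e1
  apply mul_right_cancel₀ (mul_ne_zero (mul_ne_zero (n1 r) (n2 r)) (n1 (m-r)))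
  rw [← mul_assoc, ← mul_assoc] at *
  rw [e1]
  rcases h.lt_or_eq with h | h
  · have e3 := G_eq q hq G hG1 m (r+1) h
    obtain ⟨d, rfl⟩ : ∃ d, m = r + 1 + d := ⟨m - (r+1), by omega⟩
    have : r + 1 + d - (r+1) = d := by omega
    rw [this, Dq_succ] at e3
    have : r + 1 + d - r = d+1 := by omega
    rw [this, Dq_succ] at e2
    rw [this, Dq_succ]
    linear_combination (-(q:ℂ)^(d+1) *((q:ℂ)^(r+1)-1)) * e2 - ((q:ℂ)^(d+1) - 1) * e3
  · subst h
    have h0 : Dq q 0 = 1 := by simp [Dq]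
    rw [Nat.sub_self, h0] at e2
    rw [hG2 r (r+1) (by omega), Nat.sub_self, h0]
    simp only [Nat.cast_zero, pow_zero]
    linear_combination (-((q:ℂ)^(r+1)-1)) * e2

lemma G_zero_right (q : ℕ) (G : ℕ → ℕ → ℕ)
    (hG1 : ∀ a k, k ≤ a →
      G a k * ∏ i ∈ Finset.range k, (q ^ (i + 1) - 1) =
        ∏ i ∈ Finset.range k, (q ^ (a - k + i + 1) - 1)) (m : ℕ) : G m 0 = 1 := by
  simpa using hG1 m 0 (by omega)

lemma WrecB_closed (q : ℕ) (hq : 2 ≤ q) (G : ℕ → ℕ → ℕ)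
    (hG1 : ∀ a k, k ≤ a →
      G a k * ∏ i ∈ Finset.range k, (q ^ (i + 1) - 1) =
        ∏ i ∈ Finset.range k, (q ^ (a - k + i + 1) - 1))
    (hG2 : ∀ a k, a < k → G a k = 0) (n : ℕ) : ∀ m c r : ℕ, c + r ≤ n →
    (WrecB q n m c (c + r) : ℂ) = (q : ℂ) ^ (c * (m - r)) * G m r *
      ∏ i ∈ Finset.range r, ((q : ℂ) ^ n - (q : ℂ) ^ (c + i)) := by
  intro m
  induction m with
  | zero =>
    intro c r h
    rcases r with _ | r
    · simp [WrecB, G_zero_right q G hG1]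
    · simp [WrecB, hG2 0 (r+1)]
  | succ m ih =>
    intro c r h
    have hp : q ^ c ≤ q ^ n := Nat.pow_le_pow_right (by omega) (by omega)
    simp only [WrecB]
    push_cast [Nat.cast_sub hp]
    rcases r with _ | r
    · rw [WrecB_zero q n m (c+1) (c+0) (by omega), ih c 0 h]
      simp [G_zero_right q G hG1]
      ring
    · rw [ih c (r+1) h]
      have := ih (c+1) r (by omega)
      rw [show c + 1 + r = c + (r+1) by ring] at this
      rw [this]
      rw [Finset.prod_range_succ' (fun i => ((q : ℂ) ^ n - (q : ℂ) ^ (c + i)))]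
      simp only [show ∀ i, c + 1 + i = c + (i+1) by intro i; ring, Nat.add_sub_add_right, add_zero]
      rcases lt_trichotomy r m with hr | hr | hr
      · rw [G_pascal q hq G hG1 hG2 m r hr.le]
        obtain ⟨d, rfl⟩ : ∃ d, m = r + 1 + d := ⟨m - (r+1), by omega⟩
        rw [show r + 1 + d - (r+1) = d by omega, show r + 1 + d - r = d+1 by omega]
        ring
      · subst hr
        rw [G_pascal q hq G hG1 hG2 r r le_rfl, hG2 r (r+1) (by omega)]
        simp; ring
      · rw [hG2 m (r+1) (by omega), hG2 (m+1) (r+1) (by omega), hG2 m r hr]; simp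

lemma prodGL_eq (q : ℕ) (hq : 2 ≤ q) (G : ℕ → ℕ → ℕ)
    (hG1 : ∀ a k, k ≤ a →
      G a k * ∏ i ∈ Finset.range k, (q ^ (i + 1) - 1) =
        ∏ i ∈ Finset.range k, (q ^ (a - k + i + 1) - 1)) (a r : ℕ) (h : r ≤ a) :
    ∏ i ∈ Finset.range r, ((q : ℂ) ^ a - (q : ℂ) ^ i) =
    ((∏ i ∈ Finset.range r, (q ^ r - q ^ i) : ℕ) : ℂ) * G a r := by
  have key : ∀ b, r ≤ b → ∏ i ∈ Finset.range r, ((q : ℂ) ^ b - (q : ℂ) ^ i) =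
      (∏ i ∈ Finset.range r, (q : ℂ) ^ i) *
        ∏ i ∈ Finset.range r, ((q : ℂ) ^ (b - r + i + 1) - 1) := by
    intro b hb
    rw [← Finset.prod_range_reflect (fun i => ((q : ℂ) ^ (b - r + i + 1) - 1)),
      ← Finset.prod_mul_distrib]
    apply Finset.prod_congr rfl
    intro i hi
    have := Finset.mem_range.1 hi
    rw [mul_sub, ← pow_add]
    congr 2
    · omega
    · simp
  have h1 := congrArg (Nat.cast : ℕ → ℂ) (hG1 a r h)
  have hp : ∀ n, 1 ≤ q ^ n := fun n => Nat.one_le_pow _ _ (by omega)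
  push_cast [Nat.cast_sub (hp _)] at h1
  have hc : ((∏ i ∈ Finset.range r, (q ^ r - q ^ i) : ℕ) : ℂ) =
      ∏ i ∈ Finset.range r, ((q : ℂ) ^ r - (q : ℂ) ^ i) := by
    rw [Nat.cast_prod]
    apply Finset.prod_congr rfl
    intro i hi
    have := Finset.mem_range.1 hi
    rw [Nat.cast_sub (Nat.pow_le_pow_right (by omega) (by omega))]
    push_cast; rfl
  rw [hc, key a h, key r le_rfl, ← h1]
  simp only [Nat.sub_self, zero_add]
  ring

lemma WrecB_final (q : ℕ) (hq : 2 ≤ q) (G : ℕ → ℕ → ℕ)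
    (hG1 : ∀ a k, k ≤ a →
      G a k * ∏ i ∈ Finset.range k, (q ^ (i + 1) - 1) =
        ∏ i ∈ Finset.range k, (q ^ (a - k + i + 1) - 1))
    (hG2 : ∀ a k, a < k → G a k = 0) (n m c r : ℕ) (h : c + r ≤ n) (hr : r ≤ m) :
    (WrecB q n m c (c + r) : ℂ) = (q : ℂ) ^ (c * m) *
      (((∏ i ∈ Finset.range r, (q ^ r - q ^ i) : ℕ) : ℂ) * G (n - c) r * G m r) := by
  rw [WrecB_closed q hq G hG1 hG2 n m c r h, ← prodGL_eq q hq G hG1 (n-c) r (by omega)]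
  have : ∏ i ∈ Finset.range r, ((q : ℂ) ^ n - (q : ℂ) ^ (c + i)) =
      (q : ℂ) ^ (c * r) * ∏ i ∈ Finset.range r, ((q : ℂ) ^ (n - c) - (q : ℂ) ^ i) := by
    rw [pow_mul, ← Finset.card_range r, ← Finset.prod_const, Finset.card_range,
      ← Finset.prod_mul_distrib]
    apply Finset.prod_congr rfl
    intro i _
    rw [mul_sub, ← pow_add, ← pow_add, Nat.add_sub_cancel' (by omega)]
  rw [this, show c * m = c * (m - r) + c * r by rw [← mul_add, Nat.sub_add_cancel hr], pow_add]
  ring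

section core
variable {F V : Type} [Field F] [Fintype F] [AddCommGroup V] [Module F V] [Fintype V]

lemma core_count_mem (K W : Submodule F V) (b : V) (hb : b ∈ W ⊔ K) :
    (Finset.univ.filter (fun x : K => b + x ∈ W)).card =
      Fintype.card F ^ Module.finrank F (W ⊓ K : Submodule F V) := by
  rw [← Module.card_eq_pow_finrank (K := F) (V := (W ⊓ K : Submodule F V))]
  obtain ⟨w, hw, k, hk, rfl⟩ := Submodule.mem_sup.1 hb
  rw [← Finset.card_univ]
  have e : ∀ x : V, w + k + x ∈ W ↔ k + x ∈ W := by
    intro x; rw [add_assoc]; exact Submodule.add_mem_iff_right W hw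
  refine Finset.card_bij' (fun x hx => ⟨k + x, ?_⟩) (fun y _ => ⟨y - k, ?_⟩) ?_ ?_ ?_ ?_
  · have := (Finset.mem_filter.1 hx).2
    exact ⟨(e _).1 this, K.add_mem hk x.2⟩
  · exact K.sub_mem y.2.2 hk
  · intros; simp
  · intro y _
    simp only [Finset.mem_filter, Finset.mem_univ, true_and, e]
    simpa using y.2.1
  · intro x _; ext; simp
  · intro x _; ext; simp

lemma core_count (K : Submodule F V) (e : ℕ) : ∀ (m : ℕ) (b : Fin m → V) (W : Submodule F V)
    (b' : ℕ), Module.finrank F (W ⊔ K ⊔ Submodule.span F (Set.range b) : Submodule F V) =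
      Module.finrank F (W ⊔ K : Submodule F V) + b' →
    (∑ x : Fin m → K, if Module.finrank F
      ((W ⊔ Submodule.span F (Set.range fun i => b i + (x i : V))) ⊓ K : Submodule F V) = e
        then 1 else 0) =
      Fintype.card F ^ (Module.finrank F K * b') *
        WrecB (Fintype.card F) (Module.finrank F K) (m - b')
          (Module.finrank F (W ⊓ K : Submodule F V)) e := by
  intro m
  induction m with
  | zero =>
    intro b W b' h
    have hb0 : ∀ b : Fin 0 → V, Submodule.span F (Set.range b) = ⊥ := by
      intro b; simp [Set.range_eq_empty]
    rw [hb0, sup_bot_eq] at h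
    have : b' = 0 := by omega
    subst this
    have hx : ∀ x : Fin 0 → K, (W ⊔ Submodule.span F (Set.range fun i => b i + (x i : V))) = W := by
      intro x; rw [hb0, sup_bot_eq]
    rw [Finset.sum_congr rfl (fun x _ => by rw [hx x])]
    simp [WrecB]
  | succ m ih =>
    intro b W b' h
    set n := Module.finrank F K with hn
    set c := Module.finrank F (W ⊓ K : Submodule F V) with hc
    have hbr : Set.range b = insert (b 0) (Set.range (Fin.tail b)) := by
      rw [← Fin.range_cons, Fin.cons_self_tail]
    rw [hbr, Submodule.span_insert] at h
    have hsplit : (∑ x : Fin (m+1) → K, if Module.finrank F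
      ((W ⊔ Submodule.span F (Set.range fun i => b i + (x i : V))) ⊓ K : Submodule F V) = e
        then 1 else 0) = ∑ x0 : K, ∑ x : Fin m → K, if Module.finrank F
      (((W ⊔ Submodule.span F {b 0 + (x0 : V)}) ⊔
        Submodule.span F (Set.range fun i => Fin.tail b i + (x i : V))) ⊓ K : Submodule F V) = e
        then 1 else 0 := by
      rw [← Fintype.sum_prod_type']
      symm
      apply Fintype.sum_equiv (Fin.consEquiv (fun _ => K))
      rintro ⟨x0, x⟩
      have : (Set.range fun i => b i + (((Fin.consEquiv fun _ => K) (x0, x)) i : V)) =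
          insert (b 0 + (x0 : V)) (Set.range fun i => Fin.tail b i + (x i : V)) := by
        rw [← Fin.range_cons]
        congr 1
        funext i
        refine Fin.cases ?_ (fun i => ?_) i
        · simp [Fin.consEquiv]
        · simp [Fin.consEquiv, Fin.tail]
      rw [this, Submodule.span_insert, ← sup_assoc]
    rw [hsplit]
    have hsp : ∀ x0 : K, (W ⊔ Submodule.span F {b 0 + (x0 : V)}) ⊔ K =
        W ⊔ K ⊔ Submodule.span F {b 0} := by
      intro x0
      have hx0 : (x0 : V) ∈ K := x0.2
      apply le_antisymm
      · refine sup_le (sup_le (le_sup_left.trans le_sup_left) ?_) (le_sup_right.trans le_sup_left)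
        rw [Submodule.span_singleton_le_iff_mem]
        exact Submodule.add_mem _ (Submodule.mem_sup_right (Submodule.mem_span_singleton_self _))
          (Submodule.mem_sup_left (Submodule.mem_sup_right hx0))
      · refine sup_le (sup_le (le_sup_left.trans le_sup_left) le_sup_right) ?_
        rw [Submodule.span_singleton_le_iff_mem]
        have := Submodule.sub_mem ((W ⊔ Submodule.span F {b 0 + (x0 : V)}) ⊔ K)
          (Submodule.mem_sup_left (Submodule.mem_sup_right
          (Submodule.mem_span_singleton_self (b 0 + (x0 : V))))) (Submodule.mem_sup_right hx0)
        simpa using this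
    have dW := Submodule.finrank_sup_add_finrank_inf_eq W K
    by_cases hb : b 0 ∈ W ⊔ K
    · have hs0 : W ⊔ K ⊔ Submodule.span F {b 0} = W ⊔ K := by
        rw [sup_eq_left, Submodule.span_singleton_le_iff_mem]; exact hb
      rw [← sup_assoc, hs0] at h
      have hle : b' ≤ m := by
        have h1 := Submodule.finrank_add_le_finrank_add_finrank (W ⊔ K)
          (Submodule.span F (Set.range (Fin.tail b)))
        have h2 : Module.finrank F (Submodule.span F (Set.range (Fin.tail b))) ≤ _ :=
          finrank_range_le_card (R := F) (Fin.tail b)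
        rw [Fintype.card_fin] at h2
        omega
      rw [show m + 1 - b' = (m - b') + 1 by omega]
      have hterm : ∀ x0 : K, (∑ x : Fin m → K, if Module.finrank F
        (((W ⊔ Submodule.span F {b 0 + (x0 : V)}) ⊔
          Submodule.span F (Set.range fun i => Fin.tail b i + (x i : V))) ⊓ K : Submodule F V) = e
          then 1 else 0) = if b 0 + x0 ∈ W then
            Fintype.card F ^ (n * b') * WrecB (Fintype.card F) n (m - b') c e else
            Fintype.card F ^ (n * b') * WrecB (Fintype.card F) n (m - b') (c+1) e := by
        intro x0
        rw [ih (Fin.tail b) _ b' (by rw [hsp, hs0, h])]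
        split_ifs with hx
        · have : W ⊔ Submodule.span F {b 0 + (x0 : V)} = W := by
            rw [sup_eq_left, Submodule.span_singleton_le_iff_mem]; exact hx
          rw [this]
        · have d1 := Submodule.finrank_sup_add_finrank_inf_eq
            (W ⊔ Submodule.span F {b 0 + (x0 : V)}) K
          rw [hsp, hs0, Submodule.finrank_sup_span_singleton hx] at d1
          congr 2
          omega
      rw [Finset.sum_congr rfl (fun x _ => hterm x), Finset.sum_ite, Finset.sum_const,
        Finset.sum_const]
      have c1 := core_count_mem K W (b 0) hb
      have c2 := Finset.card_filter_add_card_filter_not (s := (Finset.univ : Finset K))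
        (fun x : K => b 0 + x ∈ W)
      rw [Finset.card_univ, Module.card_eq_pow_finrank (K := F), c1, ← hn, ← hc] at c2
      rw [c1, show (Finset.univ.filter (fun x : K => ¬ (b 0 + x ∈ W))).card =
        Fintype.card F ^ n - Fintype.card F ^ c by omega]
      simp only [WrecB, smul_eq_mul]
      ring
    · have hf := Submodule.finrank_sup_span_singleton (K := F) hb
      obtain ⟨d, rfl⟩ : ∃ d, b' = d + 1 := by
        have : Module.finrank F (W ⊔ K ⊔ Submodule.span F {b 0} : Submodule F V) ≤ _ :=
          Submodule.finrank_mono (sup_le_sup_left le_sup_left _ : _ ≤ W ⊔ K ⊔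
            (Submodule.span F {b 0} ⊔ Submodule.span F (Set.range (Fin.tail b))))
        exact ⟨b' - 1, by omega⟩
      have hterm : ∀ x0 : K, (∑ x : Fin m → K, if Module.finrank F
        (((W ⊔ Submodule.span F {b 0 + (x0 : V)}) ⊔
          Submodule.span F (Set.range fun i => Fin.tail b i + (x i : V))) ⊓ K : Submodule F V) = e
          then 1 else 0) = 
            Fintype.card F ^ (n * d) * WrecB (Fintype.card F) n (m - d) c e := by
        intro x0
        have hx : b 0 + (x0 : V) ∉ W := by
          intro hx
          apply hb
          have : b 0 = (b 0 + x0) - x0 := by simp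
          rw [this]
          exact Submodule.sub_mem _ (Submodule.mem_sup_left hx) (Submodule.mem_sup_right x0.2)
        rw [ih (Fin.tail b) _ d (by rw [hsp, hf, sup_assoc, h]; ring)]
        have d1 := Submodule.finrank_sup_add_finrank_inf_eq
            (W ⊔ Submodule.span F {b 0 + (x0 : V)}) K
        rw [hsp, hf, Submodule.finrank_sup_span_singleton hx] at d1
        congr 2
        omega
      rw [Finset.sum_congr rfl (fun x _ => hterm x), Finset.sum_const, Finset.card_univ,
        Module.card_eq_pow_finrank (K := F), Nat.add_sub_add_right, smul_eq_mul, ← mul_assoc,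
        ← pow_add]
      congr 2
      rw [← hn]; ring

/-- version over an arbitrary index type -/
lemma core_count' (K : Submodule F V) (e : ℕ) {ι : Type} [Fintype ι] (b : ι → V)
    (W : Submodule F V)
    (b' : ℕ) (h : Module.finrank F (W ⊔ K ⊔ Submodule.span F (Set.range b) : Submodule F V) =
      Module.finrank F (W ⊔ K : Submodule F V) + b') :
    Nat.card {x : ι → K // Module.finrank F
      ((W ⊔ Submodule.span F (Set.range fun i => b i + (x i : V))) ⊓ K : Submodule F V) = e} =
      Fintype.card F ^ (Module.finrank F K * b') *
        WrecB (Fintype.card F) (Module.finrank F K) (Fintype.card ι - b')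
          (Module.finrank F (W ⊓ K : Submodule F V)) e := by
  let f := (Fintype.equivFin ι).symm
  have hr : Set.range (b ∘ f) = Set.range b := f.surjective.range_comp b
  have := core_count K e _ (b ∘ f) W b' (by rw [hr, h])
  rw [← this, Nat.card_eq_fintype_card, Fintype.card_subtype, Finset.card_filter]
  apply Fintype.sum_equiv (f.symm.arrowCongr (Equiv.refl K))
  intro x
  have : (Set.range fun i => (b ∘ f) i + ((f.symm.arrowCongr (Equiv.refl K)) x i : V)) =
      Set.range fun i => b i + (x i : V) := by
    rw [← f.surjective.range_comp (fun i => b i + (x i : V))]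
    rfl
  rw [this]

end core

def mskB {F : Type} [Field F] {N l : ℕ} (blk : Fin N → Fin l) (Z : Matrix (Fin N) (Fin N) F)
    (a c : ℕ) : Matrix (Fin N) (Fin N) F :=
  fun r s => if (blk r : ℕ) < a ∧ c ≤ (blk s : ℕ) then Z r s else 0

def rkB {F : Type} [Field F] {N l : ℕ} (blk : Fin N → Fin l) (Z : Matrix (Fin N) (Fin N) F)
    (a c : ℕ) : ℕ := (mskB blk Z a c).rank

def rhoB {l : ℕ} (lam : Fin l → Fin l → ℕ) (a c : ℕ) : ℕ :=
  ∑ i : Fin l, ∑ m : Fin l, if (i : ℕ) < a ∧ c ≤ (m : ℕ) then lam i m else 0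

lemma rhoB_row {l : ℕ} (lam : Fin l → Fin l → ℕ) (j : Fin l) (c : ℕ) :
    rhoB lam (j + 1) c = rhoB lam j c +
      ∑ m : Fin l, if c ≤ (m : ℕ) then lam j m else 0 := by
  have : (∑ m : Fin l, if c ≤ (m : ℕ) then lam j m else 0) =
      ∑ i, if i = j then (∑ m : Fin l, if c ≤ (m : ℕ) then lam i m else 0) else 0 := by simp
  unfold rhoB
  rw [this, ← Finset.sum_add_distrib]
  apply Finset.sum_congr rfl
  intro i _
  by_cases h : i = j
  · subst h; simp
  · have : (i : ℕ) ≠ j := fun h' => h (Fin.ext h')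
    have : (i : ℕ) < j + 1 ↔ (i : ℕ) < j := by omega
    simp [h, this]

lemma rhoB_col {l : ℕ} (lam : Fin l → Fin l → ℕ) (k : Fin l) (a : ℕ) :
    rhoB lam a k = rhoB lam a (k + 1) +
      ∑ i : Fin l, if (i : ℕ) < a then lam i k else 0 := by
  unfold rhoB
  rw [← Finset.sum_add_distrib]
  apply Finset.sum_congr rfl
  intro i _
  have : (if (i : ℕ) < a then lam i k else 0) =
      ∑ m, if m = k then (if (i : ℕ) < a then lam i m else 0) else 0 := by simp
  rw [this, ← Finset.sum_add_distrib]
  apply Finset.sum_congr rfl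
  intro m _
  by_cases h : m = k
  · subst h; simp
  · have : (m : ℕ) ≠ k := fun h' => h (Fin.ext h')
    have : (k : ℕ) ≤ m ↔ (k : ℕ) + 1 ≤ m := by omega
    simp [h, this]

lemma rhoB_zero {l : ℕ} (lam : Fin l → Fin l → ℕ) (c : ℕ) : rhoB lam 0 c = 0 := by
  simp [rhoB]

lemma rhoB_top {l : ℕ} (lam : Fin l → Fin l → ℕ) (a c : ℕ) (h : l ≤ c) : rhoB lam a c = 0 := by
  unfold rhoB
  apply Finset.sum_eq_zero; intro i _
  apply Finset.sum_eq_zero; intro m _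
  rw [if_neg]; omega

section fibre
variable {F : Type} [Field F] {N l : ℕ} (blk : Fin N → Fin l)

lemma rkB_zero (Z : Matrix (Fin N) (Fin N) F) (c : ℕ) : rkB blk Z 0 c = 0 := by
  have : mskB blk Z 0 c = 0 := by ext r s; simp [mskB]
  simp [rkB, this]

lemma rkB_top (Z : Matrix (Fin N) (Fin N) F) (a c : ℕ) (h : l ≤ c) : rkB blk Z a c = 0 := by
  have : mskB blk Z a c = 0 := by
    ext r s; simp only [mskB]; rw [if_neg]; simp; omega
  simp [rkB, this]

/-- column span -/
def cspB (M : Matrix (Fin N) (Fin N) F) : Submodule F (Fin N → F) :=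
  Submodule.span F (Set.range fun s => fun r => M r s)

lemma cspB_finrank (M : Matrix (Fin N) (Fin N) F) : Module.finrank F (cspB M) = M.rank := by
  rw [Matrix.rank_eq_finrank_span_cols]; rfl

/-- vectors supported on block `j` -/
def KB (F : Type) [Field F] {N l : ℕ} (blk : Fin N → Fin l) (j : Fin l) :
    Submodule F (Fin N → F) where
  carrier := {v | ∀ r, blk r ≠ j → v r = 0}
  add_mem' := by
    intro a b ha hb r hr
    simp [ha r hr, hb r hr]
  zero_mem' := by intro r _; rfl
  smul_mem' := by
    intro c a ha r hr
    simp [ha r hr]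

lemma mem_KB (j : Fin l) (v : Fin N → F) : v ∈ KB F blk j ↔ ∀ r, blk r ≠ j → v r = 0 := Iff.rfl

lemma finrank_KB (j : Fin l) : Module.finrank F (KB F blk j) =
    (Finset.univ.filter fun r => blk r = j).card := by
  have e : KB F blk j ≃ₗ[F] ({r // blk r = j} → F) :=
    { toFun := fun v r => v.1 r
      invFun := fun w => ⟨fun r => if h : blk r = j then w ⟨r, h⟩ else 0, by
        intro r hr; simp [hr]⟩
      left_inv := by
        intro v; ext r
        by_cases h : blk r = j
        · simp [h]
        · simp [h, v.2 r h]
      right_inv := by intro w; ext r; simp [r.2]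
      map_add' := by intros; rfl
      map_smul' := by intros; rfl }
  rw [e.finrank_eq, Module.finrank_fintype_fun_eq_card, Fintype.card_subtype]

lemma cspB_row (Z : Matrix (Fin N) (Fin N) F) (j : Fin l) (c : ℕ) :
    cspB (mskB blk Z (j + 1) c) ⊔ KB F blk j = cspB (mskB blk Z j c) ⊔ KB F blk j := by
  have hd : ∀ s, (fun r => mskB blk Z (j+1) c r s) - (fun r => mskB blk Z j c r s) ∈
      KB F blk j := by
    intro s r hr
    have : (blk r : ℕ) ≠ j := fun h' => hr (Fin.ext h')
    have : (blk r : ℕ) < j + 1 ↔ (blk r : ℕ) < j := by omega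
    simp only [mskB, Pi.sub_apply, this, sub_self]
  apply le_antisymm
  · refine sup_le (Submodule.span_le.2 ?_) le_sup_right
    rintro _ ⟨s, rfl⟩
    have := Submodule.add_mem (cspB (mskB blk Z j c) ⊔ KB F blk j)
      (Submodule.mem_sup_left (Submodule.subset_span (Set.mem_range_self s)))
      (Submodule.mem_sup_right (hd s))
    simpa using this
  · refine sup_le (Submodule.span_le.2 ?_) le_sup_right
    rintro _ ⟨s, rfl⟩
    have := Submodule.sub_mem (cspB (mskB blk Z (j+1) c) ⊔ KB F blk j)
      (Submodule.mem_sup_left (Submodule.subset_span (Set.mem_range_self s)))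
      (Submodule.mem_sup_right (hd s))
    simpa using this

lemma cspB_disj (Z : Matrix (Fin N) (Fin N) F) (j : Fin l) (c : ℕ) :
    cspB (mskB blk Z j c) ⊓ KB F blk j = ⊥ := by
  rw [eq_bot_iff]
  rintro v ⟨h1, h2⟩
  have h3 : cspB (mskB blk Z j c) ≤
      { carrier := {v | ∀ r, blk r = j → v r = 0}
        add_mem' := by
          intro a b ha hb r hr
          simp [ha r hr, hb r hr]
        zero_mem' := by intro r _; rfl
        smul_mem' := by
          intro c a ha r hr
          simp [ha r hr] } := by
    apply Submodule.span_le.2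
    rintro _ ⟨s, rfl⟩ r hr
    simp [mskB, hr]
  have h4 := h3 h1
  rw [Submodule.mem_bot]
  funext r
  by_cases hr : blk r = j
  · exact h4 r hr
  · exact h2 r hr

lemma cspB_sup_finrank (Z : Matrix (Fin N) (Fin N) F) (j : Fin l) (c : ℕ) :
    Module.finrank F (cspB (mskB blk Z j c) ⊔ KB F blk j : Submodule F (Fin N → F)) =
      rkB blk Z j c + Module.finrank F (KB F blk j) := by
  have := Submodule.finrank_sup_add_finrank_inf_eq (cspB (mskB blk Z j c)) (KB F blk j)
  rw [cspB_disj, finrank_bot, cspB_finrank] at this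
  exact this

lemma cspB_col (Z : Matrix (Fin N) (Fin N) F) (k : Fin l) (a : ℕ) :
    cspB (mskB blk Z a k) = cspB (mskB blk Z a (k+1)) ⊔
      Submodule.span F (Set.range fun s : {s // blk s = k} => fun r => mskB blk Z a k r s) := by
  have h1 : ∀ s, blk s ≠ k → ∀ r, mskB blk Z a k r s = mskB blk Z a (k+1) r s := by
    intro s hs r
    have : (blk s : ℕ) ≠ k := fun h' => hs (Fin.ext h')
    have : (k : ℕ) ≤ blk s ↔ (k : ℕ) + 1 ≤ blk s := by omega
    simp [mskB, this]
  apply le_antisymm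
  · refine Submodule.span_le.2 ?_
    rintro _ ⟨s, rfl⟩
    by_cases hs : blk s = k
    · exact Submodule.mem_sup_right (Submodule.subset_span ⟨⟨s, hs⟩, rfl⟩)
    · refine Submodule.mem_sup_left (Submodule.subset_span ⟨s, ?_⟩)
      funext r; exact (h1 s hs r).symm
  · refine sup_le (Submodule.span_le.2 ?_) (Submodule.span_le.2 ?_)
    · rintro _ ⟨s, rfl⟩
      by_cases hs : blk s = k
      · have : (fun r => mskB blk Z a (k+1) r s) = 0 := by
          funext r; simp [mskB, hs]
        simp only [this]
        exact Submodule.zero_mem _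
      · refine Submodule.subset_span ⟨s, ?_⟩
        funext r; exact (h1 s hs r)
    · rintro _ ⟨s, rfl⟩
      exact Submodule.subset_span ⟨s, rfl⟩

def suppB (D : Finset (Fin l × Fin l)) (Z : Matrix (Fin N) (Fin N) F) : Prop :=
  ∀ r s, (blk r, blk s) ∉ D → Z r s = 0

def IsUpB (D : Finset (Fin l × Fin l)) : Prop :=
  ∀ i m i' m', (i, m) ∈ D → i' ≤ i → m ≤ m' → (i', m') ∈ D

def SB (lam : Fin l → Fin l → ℕ) (D : Finset (Fin l × Fin l))
    (Z : Matrix (Fin N) (Fin N) F) : Prop :=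
  suppB blk D Z ∧ ∀ i m, (i, m) ∈ D → rkB blk Z (i + 1) m = rhoB lam (i + 1) m

lemma SB_rk (lam : Fin l → Fin l → ℕ) (D : Finset (Fin l × Fin l))
    (Z : Matrix (Fin N) (Fin N) F) (h : SB blk lam D Z) (a c : ℕ)
    (hac : ∀ i m : Fin l, (i : ℕ) + 1 = a → (m : ℕ) = c → (i, m) ∈ D) (ha : a ≤ l) :
    rkB blk Z a c = rhoB lam a c := by
  rcases a with _ | a
  · rw [rkB_zero, rhoB_zero]
  · by_cases hc : c < l
    · exact h.2 ⟨a, by omega⟩ ⟨c, hc⟩ (hac _ _ rfl rfl)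
    · rw [rkB_top _ _ _ _ (by omega), rhoB_top _ _ _ (by omega)]

def dropB (D : Finset (Fin l × Fin l)) (Z : Matrix (Fin N) (Fin N) F) :
    Matrix (Fin N) (Fin N) F := fun r s => if (blk r, blk s) ∈ D then Z r s else 0

def insB (j k : Fin l) (Y : Matrix (Fin N) (Fin N) F)
    (x : {s // blk s = k} → KB F blk j) : Matrix (Fin N) (Fin N) F :=
  fun r s => if h : blk s = k then (if blk r = j then (x ⟨s, h⟩ : Fin N → F) r else Y r s)
    else Y r s

lemma mskB_congr (Z Y : Matrix (Fin N) (Fin N) F) (a c : ℕ)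
    (h : ∀ r s, (blk r : ℕ) < a → c ≤ (blk s : ℕ) → Z r s = Y r s) :
    mskB blk Z a c = mskB blk Y a c := by
  ext r s
  simp only [mskB]
  split_ifs with h'
  · exact h r s h'.1 h'.2
  · rfl

lemma insB_ne (j k : Fin l) (Y : Matrix (Fin N) (Fin N) F)
    (x : {s // blk s = k} → KB F blk j) (r s : Fin N) (h : ¬ (blk r = j ∧ blk s = k)) :
    insB blk j k Y x r s = Y r s := by
  unfold insB
  by_cases h1 : blk s = k
  · have : ¬ blk r = j := fun h2 => h ⟨h2, h1⟩
    simp [h1, this]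
  · simp [h1]

lemma insB_SB_iff [Fintype F] (lam : Fin l → Fin l → ℕ) (D : Finset (Fin l × Fin l))
    (hD : IsUpB D) (j k : Fin l)
    (hp : (j, k) ∉ D) (hD' : IsUpB (insert (j, k) D)) (Y : Matrix (Fin N) (Fin N) F)
    (hY : SB blk lam D Y) (x : {s // blk s = k} → KB F blk j) :
    SB blk lam (insert (j, k) D) (insB blk j k Y x) ↔
    Module.finrank F ((cspB (mskB blk Y (j+1) (k+1)) ⊔
      Submodule.span F (Set.range fun s : {s // blk s = k} => (fun r => mskB blk Y j k r s) +
        (x s : Fin N → F))) ⊓ KB F blk j : Submodule F (Fin N → F)) =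
      (∑ m : Fin l, if (k : ℕ) + 1 ≤ m then lam j m else 0) + lam j k := by
  set Z := insB blk j k Y x with hZ
  have hpos : ∀ i m : Fin l, (i, m) ∈ D → ¬ (j ≤ i ∧ m ≤ k) := by
    intro i m him h
    exact hp (hD i m j k him h.1 h.2)
  have hrk : ∀ i m : Fin l, (i, m) ∈ D → rkB blk Z (i+1) m = rkB blk Y (i+1) m := by
    intro i m him
    unfold rkB
    rw [mskB_congr blk Z Y]
    intro r s hr hs
    apply insB_ne
    rintro ⟨rfl, rfl⟩
    exact hpos i m him ⟨by rw [Fin.le_def]; omega, hs⟩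
  have h1 : SB blk lam (insert (j, k) D) Z ↔ rkB blk Z (j+1) k = rhoB lam (j+1) k := by
    constructor
    · intro h; exact h.2 j k (Finset.mem_insert_self _ _)
    · intro h
      refine ⟨?_, ?_⟩
      · intro r s hrs
        rw [Finset.mem_insert, not_or] at hrs
        rw [hZ, insB_ne, hY.1 r s hrs.2]
        rintro ⟨rfl, rfl⟩; exact hrs.1 rfl
      · intro i m him
        rcases Finset.mem_insert.1 him with h' | h'
        · cases h'; exact h
        · rw [hrk i m h', hY.2 i m h']
  rw [h1]
  have hA : cspB (mskB blk Y (j+1) (k+1)) ⊔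
      Submodule.span F (Set.range fun s : {s // blk s = k} => (fun r => mskB blk Y j k r s) +
        (x s : Fin N → F)) = cspB (mskB blk Z (j+1) k) := by
    rw [cspB_col]
    congr 2
    · apply mskB_congr
      intro r s _ hs
      symm
      apply insB_ne
      rintro ⟨_, rfl⟩; omega
    · congr 1
      funext s r
      have hs := s.2
      by_cases hr : blk r = j
      · simp [mskB, hZ, insB, hs, hr]
      · have h2 : (blk r : ℕ) ≠ j := fun h' => hr (Fin.ext h')
        have h2 : (blk r : ℕ) < j + 1 ↔ (blk r : ℕ) < j := by omega
        have h3 := (x s).2 r hr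
        simp [mskB, hZ, insB, hs, hr, h2, h3]
  rw [hA]
  have d := Submodule.finrank_sup_add_finrank_inf_eq (cspB (mskB blk Z (j+1) k)) (KB F blk j)
  rw [cspB_row, cspB_sup_finrank, cspB_finrank] at d
  have e1 : rkB blk Z j k = rhoB lam j k := by
    have : rkB blk Z j k = rkB blk Y j k := by
      unfold rkB
      rw [mskB_congr blk Z Y]
      intro r s hr hs
      apply insB_ne
      rintro ⟨rfl, rfl⟩
      omega
    rw [this]
    apply SB_rk blk lam D Y hY
    · intro i m hi hm
      have := hD' j k i m (Finset.mem_insert_self _ _) (by rw [Fin.le_def]; omega) (by rw [Fin.le_def]; omega)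
      rcases Finset.mem_insert.1 this with h | h
      · simp only [Prod.mk.injEq] at h; rw [h.1] at hi; omega
      · exact h
    · omega
  have e2 := rhoB_row lam j k
  have e3 : (∑ m : Fin l, if (k : ℕ) ≤ m then lam j m else 0) =
      (∑ m : Fin l, if (k : ℕ) + 1 ≤ m then lam j m else 0) + lam j k := by
    have : lam j k = ∑ m, if m = k then lam j m else 0 := by simp
    rw [this, ← Finset.sum_add_distrib]
    apply Finset.sum_congr rfl
    intro m _
    by_cases h : m = k
    · subst h; simp
    · have : (m : ℕ) ≠ k := fun h' => h (Fin.ext h')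
      have : (k : ℕ) ≤ m ↔ (k : ℕ) + 1 ≤ m := by omega
      simp [h, this]
  change _ = rkB blk Z (j+1) k + _ at d
  omega

lemma fibre_card [Fintype F] (lam : Fin l → Fin l → ℕ) (D : Finset (Fin l × Fin l))
    (hD : IsUpB D) (j k : Fin l)
    (hp : (j, k) ∉ D) (hD' : IsUpB (insert (j, k) D)) (Y : Matrix (Fin N) (Fin N) F)
    (hY : SB blk lam D Y) (βj βk : ℕ)
    (hβj : (Finset.univ.filter fun r => blk r = j).card = βj)
    (hβk : (Finset.univ.filter fun r => blk r = k).card = βk) :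
    Nat.card {Z : Matrix (Fin N) (Fin N) F // SB blk lam (insert (j, k) D) Z ∧
      dropB blk D Z = Y} =
    Fintype.card F ^ (βj * (∑ i : Fin l, if (i : ℕ) < j then lam i k else 0)) *
      WrecB (Fintype.card F) βj (βk - (∑ i : Fin l, if (i : ℕ) < j then lam i k else 0))
        (∑ m : Fin l, if (k : ℕ) + 1 ≤ m then lam j m else 0)
        ((∑ m : Fin l, if (k : ℕ) + 1 ≤ m then lam j m else 0) + lam j k) := by
  set b' := (∑ i : Fin l, if (i : ℕ) < j then lam i k else 0)
  set c := (∑ m : Fin l, if (k : ℕ) + 1 ≤ m then lam j m else 0)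
  have hK : Module.finrank F (KB F blk j) = βj := by rw [finrank_KB, hβj]
  have hk : Fintype.card {s // blk s = k} = βk := by rw [Fintype.card_subtype, hβk]
  have hmem : ∀ i m : Fin l, i ≤ j → k ≤ m → (i, m) ≠ (j, k) → (i, m) ∈ D := by
    intro i m hi hm hne
    have := hD' j k i m (Finset.mem_insert_self _ _) hi hm
    exact (Finset.mem_insert.1 this).resolve_left hne
  have r1 : rkB blk Y (j+1) (k+1) = rhoB lam (j+1) (k+1) := by
    apply SB_rk blk lam D Y hY
    · intro i m hi hm
      apply hmem i m (by rw [Fin.le_def]; omega) (by rw [Fin.le_def]; omega)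
      intro h; simp only [Prod.mk.injEq] at h; rw [h.2] at hm; omega
    · omega
  have r2 : rkB blk Y j (k+1) = rhoB lam j (k+1) := by
    apply SB_rk blk lam D Y hY
    · intro i m hi hm
      apply hmem i m (by rw [Fin.le_def]; omega) (by rw [Fin.le_def]; omega)
      intro h; simp only [Prod.mk.injEq] at h; rw [h.2] at hm; omega
    · omega
  have r3 : rkB blk Y j k = rhoB lam j k := by
    apply SB_rk blk lam D Y hY
    · intro i m hi hm
      apply hmem i m (by rw [Fin.le_def]; omega) (by rw [Fin.le_def]; omega)
      intro h; simp only [Prod.mk.injEq] at h; rw [h.1] at hi; omega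
    · omega
  have hb' : Module.finrank F (cspB (mskB blk Y (j+1) (k+1)) ⊔ KB F blk j ⊔
      Submodule.span F (Set.range fun s : {s // blk s = k} => (fun r => mskB blk Y j k r s)) :
        Submodule F (Fin N → F)) =
      Module.finrank F (cspB (mskB blk Y (j+1) (k+1)) ⊔ KB F blk j :
        Submodule F (Fin N → F)) + b' := by
    rw [cspB_row, sup_right_comm, ← cspB_col, cspB_sup_finrank, cspB_sup_finrank, r2, r3]
    have := rhoB_col lam k j
    omega
  have hc : Module.finrank F (cspB (mskB blk Y (j+1) (k+1)) ⊓ KB F blk j :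
      Submodule F (Fin N → F)) = c := by
    have d := Submodule.finrank_sup_add_finrank_inf_eq (cspB (mskB blk Y (j+1) (k+1)))
      (KB F blk j)
    rw [cspB_row, cspB_sup_finrank, cspB_finrank] at d
    change _ = rkB blk Y (j+1) (k+1) + _ at d
    have := rhoB_row lam j (k+1)
    rw [r1, r2] at d
    omega
  have main := core_count' (KB F blk j) (c + lam j k)
    (fun s : {s // blk s = k} => (fun r => mskB blk Y j k r s))
    (cspB (mskB blk Y (j+1) (k+1))) b' hb'
  rw [hK, hk, hc] at main
  rw [← main]
  symm
  have hY0 : ∀ r s, blk r = j → blk s = k → Y r s = 0 := by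
    intro r s hr hs; apply hY.1; rw [hr, hs]; exact hp
  have hZ : ∀ Z : Matrix (Fin N) (Fin N) F, SB blk lam (insert (j, k) D) Z → dropB blk D Z = Y →
      insB blk j k Y (fun s => ⟨fun r => if blk r = j then Z r s else 0, by
        intro r hr; simp [hr]⟩) = Z := by
    intro Z h1 h2
    ext r s
    by_cases h : blk r = j ∧ blk s = k
    · simp [insB, h.1, h.2]
    · rw [insB_ne blk j k _ _ _ _ h, ← h2]
      simp only [dropB]
      split_ifs with h3
      · rfl
      · symm
        apply h1.1
        rw [Finset.mem_insert, not_or]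
        refine ⟨?_, h3⟩
        intro h4; simp only [Prod.mk.injEq] at h4; exact h h4
  refine Nat.card_congr
    { toFun := fun x => ⟨insB blk j k Y x.1, ?_, ?_⟩
      invFun := fun Z => ⟨fun s => ⟨fun r => if blk r = j then Z.1 r s else 0, ?_⟩, ?_⟩
      left_inv := ?_
      right_inv := ?_ }
  · exact (insB_SB_iff blk lam D hD j k hp hD' Y hY x.1).2 x.2
  · ext r s
    simp only [dropB]
    split_ifs with h
    · apply insB_ne
      rintro ⟨rfl, rfl⟩; exact hp h
    · exact (hY.1 r s h).symm
  · intro r hr; simp [hr]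
  · refine (insB_SB_iff blk lam D hD j k hp hD' Y hY _).1 ?_
    rw [hZ Z.1 Z.2.1 Z.2.2]; exact Z.2.1
  · intro x
    ext s r
    by_cases hr : blk r = j
    · simp [insB, hr, s.2]
    · simp [hr, (x.1 s).2 r hr]
  · intro Z
    apply Subtype.ext
    exact hZ Z.1 Z.2.1 Z.2.2

end fibre

section total
variable {F : Type} [Field F] [Fintype F] {N l : ℕ} (blk : Fin N → Fin l)

def wB (q : ℕ) (β : Fin l → ℕ) (lam : Fin l → Fin l → ℕ) (j k : Fin l) : ℕ :=
  q ^ (β j * (∑ i : Fin l, if (i : ℕ) < j then lam i k else 0)) *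
      WrecB q (β j) (β k - (∑ i : Fin l, if (i : ℕ) < j then lam i k else 0))
        (∑ m : Fin l, if (k : ℕ) + 1 ≤ m then lam j m else 0)
        ((∑ m : Fin l, if (k : ℕ) + 1 ≤ m then lam j m else 0) + lam j k)

lemma dropB_SB (lam : Fin l → Fin l → ℕ) (D : Finset (Fin l × Fin l)) (p : Fin l × Fin l)
    (hD : IsUpB D) (Z : Matrix (Fin N) (Fin N) F) (h : SB blk lam (insert p D) Z) :
    SB blk lam D (dropB blk D Z) := by
  refine ⟨?_, ?_⟩
  · intro r s hrs; simp [dropB, hrs]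
  · intro i m him
    rw [← h.2 i m (Finset.mem_insert_of_mem him)]
    unfold rkB
    rw [mskB_congr blk]
    intro r s hr hs
    have : (blk r, blk s) ∈ D := hD i m _ _ him (by rw [Fin.le_def]; omega) hs
    simp [dropB, this]

lemma SB_card (β : Fin l → ℕ)
    (hcard : ∀ i, (Finset.univ.filter fun r => blk r = i).card = β i)
    (lam : Fin l → Fin l → ℕ) : ∀ (n : ℕ) (D : Finset (Fin l × Fin l)), D.card = n → IsUpB D →
    (Finset.univ.filter (fun Z : Matrix (Fin N) (Fin N) F => SB blk lam D Z)).card =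
      ∏ p ∈ D, wB (Fintype.card F) β lam p.1 p.2 := by
  intro n
  induction n with
  | zero =>
    intro D hn hD
    have : D = ∅ := Finset.card_eq_zero.1 hn
    subst this
    rw [Finset.prod_empty, Finset.card_eq_one]
    refine ⟨0, ?_⟩
    ext Z
    simp only [Finset.mem_filter, Finset.mem_univ, true_and, Finset.mem_singleton]
    constructor
    · intro h; ext r s; exact h.1 r s (by simp)
    · rintro rfl; exact ⟨fun _ _ _ => rfl, by simp⟩
  | succ n ih =>
    intro D hn hD
    have hne : D.Nonempty := by rw [← Finset.card_pos]; omega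
    obtain ⟨⟨j, k⟩, hp, hmax⟩ := Finset.exists_max_image D
      (fun p => (p.1 : ℕ) + (l - (p.2 : ℕ))) hne
    have hE : IsUpB (D.erase (j, k)) := by
      intro i m i' m' him hi hm
      rw [Finset.mem_erase] at him ⊢
      refine ⟨?_, hD i m i' m' him.2 hi hm⟩
      intro h
      simp only [Prod.mk.injEq] at h
      obtain ⟨rfl, rfl⟩ := h
      have := hmax _ him.2
      apply him.1
      rw [Fin.le_def] at hi hm
      simp only [Prod.mk.injEq, Fin.ext_iff]
      simp only at this
      omega
    have hins : insert (j, k) (D.erase (j, k)) = D := Finset.insert_erase hp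
    rw [← Finset.mul_prod_erase D _ hp, ← ih (D.erase (j, k)) (by
      rw [Finset.card_erase_of_mem hp]; omega) hE]
    have hmaps : ∀ Z ∈ (Finset.univ.filter (fun Z : Matrix (Fin N) (Fin N) F => SB blk lam D Z)),
        dropB blk (D.erase (j, k)) Z ∈
        (Finset.univ.filter (fun Z : Matrix (Fin N) (Fin N) F =>
          SB blk lam (D.erase (j, k)) Z)) := by
      intro Z hZ
      simp only [Finset.mem_filter, Finset.mem_univ, true_and] at hZ ⊢
      apply dropB_SB blk lam _ (j, k) hE
      rw [hins]; exact hZ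
    rw [Finset.card_eq_sum_card_fiberwise hmaps, Finset.sum_const_nat (m :=
      wB (Fintype.card F) β lam j k), mul_comm]
    intro Y hY
    simp only [Finset.mem_filter, Finset.mem_univ, true_and] at hY
    have := fibre_card blk lam (D.erase (j, k)) hE j k (Finset.notMem_erase _ _)
      (by rw [hins]; exact hD) Y hY (β j) (β k) (hcard j) (hcard k)
    rw [hins, Nat.card_eq_fintype_card, Fintype.card_subtype] at this
    unfold wB
    rw [← this, Finset.filter_filter]

end total

lemma IsUpB_induction {l : ℕ} (motive : Finset (Fin l × Fin l) → Prop) (h0 : motive ∅)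
    (hins : ∀ D p, IsUpB D → p ∉ D → IsUpB (insert p D) → motive D → motive (insert p D)) :
    ∀ (n : ℕ) (D : Finset (Fin l × Fin l)), D.card = n → IsUpB D → motive D := by
  intro n
  induction n with
  | zero =>
    intro D hn hD
    have : D = ∅ := Finset.card_eq_zero.1 hn
    subst this
    exact h0
  | succ n ih =>
    intro D hn hD
    have hne : D.Nonempty := by rw [← Finset.card_pos]; omega
    obtain ⟨⟨j, k⟩, hp, hmax⟩ := Finset.exists_max_image D
      (fun p => (p.1 : ℕ) + (l - (p.2 : ℕ))) hne
    have hE : IsUpB (D.erase (j, k)) := by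
      intro i m i' m' him hi hm
      rw [Finset.mem_erase] at him ⊢
      refine ⟨?_, hD i m i' m' him.2 hi hm⟩
      intro h
      simp only [Prod.mk.injEq] at h
      obtain ⟨rfl, rfl⟩ := h
      have := hmax _ him.2
      apply him.1
      rw [Fin.le_def] at hi hm
      simp only [Prod.mk.injEq, Fin.ext_iff]
      simp only at this
      omega
    have hi : insert (j, k) (D.erase (j, k)) = D := Finset.insert_erase hp
    rw [← hi]
    exact hins _ _ hE (Finset.notMem_erase _ _) (by rw [hi]; exact hD)
      (ih _ (by rw [Finset.card_erase_of_mem hp]; omega) hE)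

/-- rank of a partial permutation matrix -/
lemma rank_ppm {F m n : Type} [Field F] [Fintype m] [Fintype n] (M : Matrix m n F)
    (h1 : ∀ r s, M r s = 0 ∨ M r s = 1)
    (h2 : ∀ r s t, M r s ≠ 0 → M r t ≠ 0 → s = t)
    (h3 : ∀ r s t, M r t ≠ 0 → M s t ≠ 0 → r = s) :
    M.rank = (Finset.univ.filter (fun p : m × n => M p.1 p.2 ≠ 0)).card := by
  rw [Matrix.rank_eq_finrank_span_cols, ← Fintype.card_subtype]
  have hli : LinearIndependent F (fun p : {p : m × n // M p.1 p.2 ≠ 0} =>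
      (Pi.single p.1.1 1 : m → F)) := by
    have := (Pi.basisFun F m).linearIndependent.comp
      (fun p : {p : m × n // M p.1 p.2 ≠ 0} => p.1.1) (by
        rintro ⟨⟨a, b⟩, hp⟩ ⟨⟨a', b'⟩, hq⟩ h
        simp only at h hp hq
        subst h
        simp [h2 a b b' hp hq])
    convert this using 1
    funext p
    simp
  rw [← finrank_span_eq_card hli]
  have hcol : ∀ r s, M r s ≠ 0 → M.col s = Pi.single r 1 := by
    intro r s h
    funext r'
    by_cases hr : r' = r
    · subst hr; simpa using (h1 r' s).resolve_left h
    · rw [Pi.single_eq_of_ne hr]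
      by_contra h'
      exact hr (h3 r' r s h' h)
  have : Submodule.span F (Set.range M.col) = Submodule.span F (Set.range
      (fun p : {p : m × n // M p.1 p.2 ≠ 0} => (Pi.single p.1.1 1 : m → F))) := by
    apply le_antisymm
    · apply Submodule.span_le.2
      rintro _ ⟨s, rfl⟩
      by_cases h : ∃ r, M r s ≠ 0
      · obtain ⟨r, hr⟩ := h
        rw [hcol r s hr]
        exact Submodule.subset_span ⟨⟨(r, s), hr⟩, rfl⟩
      · push Not at h
        have : M.col s = 0 := by funext r; exact h r
        rw [this]; exact Submodule.zero_mem _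
    · apply Submodule.span_le.2
      rintro _ ⟨⟨⟨r, s⟩, h⟩, rfl⟩
      exact Submodule.subset_span ⟨s, hcol r s h⟩
  rw [this]

section
variable {F : Type} [Field F] {N l : ℕ} (blk : Fin N → Fin l)

def cntB (Z : Matrix (Fin N) (Fin N) F) (i k : Fin l) : ℕ :=
  (Finset.univ.filter (fun p : Fin N × Fin N =>
    Z p.1 p.2 ≠ 0 ∧ blk p.1 = i ∧ blk p.2 = k)).card

lemma cntB_blockRank (Z : Matrix (Fin N) (Fin N) F) (hZ : IsPPM Z) (i k : Fin l) :
    blockRank blk Z i k = cntB blk Z i k := by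
  unfold blockRank cntB
  rw [rank_ppm]
  · refine Finset.card_bij (fun p _ => (p.1.1, p.2.1)) ?_ ?_ ?_
    · rintro ⟨a, b⟩ h
      exact Finset.mem_filter.2 ⟨Finset.mem_univ _, (Finset.mem_filter.1 h).2, a.2, b.2⟩
    · rintro ⟨a, b⟩ _ ⟨a', b'⟩ _ h
      simp only [Prod.mk.injEq] at h ⊢
      exact ⟨Subtype.ext h.1, Subtype.ext h.2⟩
    · rintro ⟨a, b⟩ h
      have h := (Finset.mem_filter.1 h).2
      exact ⟨(⟨a, h.2.1⟩, ⟨b, h.2.2⟩), Finset.mem_filter.2 ⟨Finset.mem_univ _, h.1⟩, rfl⟩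
  · intro r s; exact hZ.1 r s
  · intro r s t h h'; exact Subtype.ext (hZ.2.1 r s t h h')
  · intro r s t h h'; exact Subtype.ext (hZ.2.2 r s t h h')

lemma rkB_ppm (Z : Matrix (Fin N) (Fin N) F) (hZ : IsPPM Z) (a c : ℕ) :
    rkB blk Z a c = rhoB (cntB blk Z) a c := by
  have hm : ∀ r s, mskB blk Z a c r s ≠ 0 ↔ Z r s ≠ 0 ∧ (blk r : ℕ) < a ∧ c ≤ (blk s : ℕ) := by
    intro r s
    simp only [mskB]
    split_ifs with h
    · simp [h]
    · exact ⟨fun h' => absurd rfl h', fun h' => absurd h'.2 h⟩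
  unfold rkB
  rw [rank_ppm]
  · rw [Finset.card_eq_sum_card_fiberwise (t := Finset.univ)
      (f := fun p : Fin N × Fin N => (blk p.1, blk p.2)) (by intro p _; simp),
      Fintype.sum_prod_type]
    unfold rhoB
    apply Finset.sum_congr rfl; intro i _
    apply Finset.sum_congr rfl; intro k _
    rw [Finset.filter_filter]
    split_ifs with h
    · unfold cntB
      congr 1
      ext ⟨r, s⟩
      simp only [Finset.mem_filter, Finset.mem_univ, true_and, hm, Prod.mk.injEq]
      constructor
      · rintro ⟨⟨h1, _⟩, h2⟩; exact ⟨h1, h2⟩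
      · rintro ⟨h1, rfl, rfl⟩; exact ⟨⟨h1, h⟩, rfl, rfl⟩
    · rw [Finset.card_eq_zero]
      ext ⟨r, s⟩
      simp only [Finset.mem_filter, Finset.mem_univ, true_and, hm, Prod.mk.injEq,
        Finset.notMem_empty, iff_false]
      rintro ⟨⟨h1, h2⟩, rfl, rfl⟩; exact h h2
  · intro r s
    simp only [mskB]
    split_ifs
    · exact hZ.1 r s
    · exact Or.inl rfl
  · intro r s t h h'; exact hZ.2.1 r s t ((hm _ _).1 h).1 ((hm _ _).1 h').1
  · intro r s t h h'; exact hZ.2.2 r s t ((hm _ _).1 h).1 ((hm _ _).1 h').1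

lemma rhoB_entry (lam : Fin l → Fin l → ℕ) (j k : Fin l) :
    rhoB lam (j+1) k + rhoB lam j (k+1) = rhoB lam j k + rhoB lam (j+1) (k+1) + lam j k := by
  have e0 := rhoB_row lam j k
  have e1 := rhoB_row lam j (k+1)
  have e3 : (∑ m : Fin l, if (k : ℕ) ≤ m then lam j m else 0) =
      (∑ m : Fin l, if (k : ℕ) + 1 ≤ m then lam j m else 0) + lam j k := by
    have : lam j k = ∑ m, if m = k then lam j m else 0 := by simp
    rw [this, ← Finset.sum_add_distrib]
    apply Finset.sum_congr rfl
    intro m _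
    by_cases h : m = k
    · subst h; simp
    · have : (m : ℕ) ≠ k := fun h' => h (Fin.ext h')
      have : (k : ℕ) ≤ m ↔ (k : ℕ) + 1 ≤ m := by omega
      simp [h, this]
  omega

/-- invertible block lower triangular -/
def LowB (g : Matrix (Fin N) (Fin N) F) : Prop :=
  IsUnit g ∧ ∀ r s, blk r < blk s → g r s = 0

lemma LowB_one : LowB blk (1 : Matrix (Fin N) (Fin N) F) :=
  ⟨isUnit_one, fun r s h => Matrix.one_apply_ne (by rintro rfl; exact lt_irrefl _ h)⟩

lemma LowB_mul {g h : Matrix (Fin N) (Fin N) F} (hg : LowB blk g) (hh : LowB blk h) :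
    LowB blk (g * h) := by
  refine ⟨hg.1.mul hh.1, fun r s hrs => ?_⟩
  rw [Matrix.mul_apply]
  apply Finset.sum_eq_zero
  intro t _
  by_cases h1 : blk r < blk t
  · rw [hg.2 r t h1, zero_mul]
  · rw [hh.2 t s (lt_of_le_of_lt (not_lt.1 h1) hrs), mul_zero]

lemma LowB_inv {g : Matrix (Fin N) (Fin N) F} (hg : LowB blk g) :
    ∃ g', LowB blk g' ∧ g' * g = 1 ∧ g * g' = 1 := by
  have hd : IsUnit g.det := (Matrix.isUnit_iff_isUnit_det g).1 hg.1
  have : Invertible g := Matrix.invertibleOfIsUnitDet g hd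
  have ht : Matrix.BlockTriangular g (OrderDual.toDual ∘ blk) := by
    intro r s h; exact hg.2 r s h
  refine ⟨g⁻¹, ⟨(Matrix.isUnit_nonsing_inv_iff).2 hg.1, ?_⟩, Matrix.nonsing_inv_mul g hd,
    Matrix.mul_nonsing_inv g hd⟩
  intro r s h
  exact Matrix.blockTriangular_inv_of_blockTriangular ht h

def NormB (P : Fin l → Fin l → Prop) : Prop :=
  ∀ i m i' m', P i m → i' ≤ i → m ≤ m' → P i' m'

lemma trunc_trunc (P : Fin l → Fin l → Prop) (hP : NormB P)
    {g h : Matrix (Fin N) (Fin N) F} (hg : LowB blk g) (hh : LowB blk h)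
    (Y : Matrix (Fin N) (Fin N) F) :
    trunc (fatR blk P) (g * trunc (fatR blk P) Y * h) = trunc (fatR blk P) (g * Y * h) := by
  ext r s
  simp only [trunc]
  split_ifs with hrs
  · simp only [Matrix.mul_apply]
    apply Finset.sum_congr rfl; intro t _
    by_cases h1 : blk t < blk s
    · rw [hh.2 t s h1, mul_zero, mul_zero]
    congr 1
    apply Finset.sum_congr rfl; intro u _
    by_cases h2 : blk r < blk u
    · rw [hg.2 r u h2, zero_mul, zero_mul]
    have : trunc (fatR blk P) Y u t = Y u t :=
      if_pos (hP _ _ _ _ hrs (not_lt.1 h2) (not_lt.1 h1))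
    rw [this]
  · rfl

lemma rkB_trunc_le (P : Fin l → Fin l → Prop) (hP : NormB P)
    {g h : Matrix (Fin N) (Fin N) F} (hg : LowB blk g) (hh : LowB blk h)
    (Y : Matrix (Fin N) (Fin N) F) (i m : Fin l) (him : P i m) :
    rkB blk (trunc (fatR blk P) (g * Y * h)) (i+1) m ≤ rkB blk Y (i+1) m := by
  have : mskB blk (trunc (fatR blk P) (g * Y * h)) (i+1) m =
      (Matrix.of fun r u => if (blk r : ℕ) < i + 1 then g r u else 0 : Matrix (Fin N) (Fin N) F) *
        mskB blk Y (i+1) m *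
        (Matrix.of fun t s => if (m : ℕ) ≤ blk s then h t s else 0 : Matrix (Fin N) (Fin N) F) := by
    ext r s
    simp only [Matrix.mul_apply, Matrix.of_apply]
    by_cases hr : (blk r : ℕ) < i + 1
    · by_cases hs : (m : ℕ) ≤ blk s
      · have hp : fatR blk P r s := hP _ _ _ _ him (by rw [Fin.le_def]; omega) hs
        simp only [mskB, hr, hs, and_self, if_true, trunc, hp, Matrix.mul_apply]
        apply Finset.sum_congr rfl; intro t _
        by_cases h1 : blk t < blk s
        · rw [hh.2 t s h1, mul_zero, mul_zero]
        congr 1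
        apply Finset.sum_congr rfl; intro u _
        by_cases h2 : blk r < blk u
        · rw [hg.2 r u h2, zero_mul, zero_mul]
        rw [not_lt, Fin.le_def] at h1 h2
        rw [if_pos]
        constructor <;> omega
      · simp [mskB, hs]
    · simp only [mskB, hr, false_and, if_false]
      simp
  unfold rkB
  rw [this]
  exact (Matrix.rank_mul_le_left _ _).trans (Matrix.rank_mul_le_right _ _)

lemma orb_symm (P : Fin l → Fin l → Prop) (hP : NormB P)
    {g h : Matrix (Fin N) (Fin N) F} (hg : LowB blk g) (hh : LowB blk h)
    (Y : Matrix (Fin N) (Fin N) F) (hY : Y ∈ utAlg F (fatR blk P)) :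
    ∃ g' h', LowB blk g' ∧ LowB blk h' ∧
      Y = trunc (fatR blk P) (g' * trunc (fatR blk P) (g * Y * h) * h') := by
  obtain ⟨g', hg', h1, _⟩ := LowB_inv blk hg
  obtain ⟨h', hh', _, h2⟩ := LowB_inv blk hh
  refine ⟨g', h', hg', hh', ?_⟩
  rw [trunc_trunc blk P hP hg' hh']
  have : g' * (g * Y * h) * h' = Y := by
    calc g' * (g * Y * h) * h' = (g' * g) * Y * (h * h') := by simp only [Matrix.mul_assoc]
      _ = Y := by rw [h1, h2, Matrix.one_mul, Matrix.mul_one]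
  rw [this]
  ext r s
  simp only [trunc]
  split_ifs with hrs
  · rfl
  · exact hY r s hrs

lemma rkB_trunc (P : Fin l → Fin l → Prop) (hP : NormB P)
    {g h : Matrix (Fin N) (Fin N) F} (hg : LowB blk g) (hh : LowB blk h)
    (Y : Matrix (Fin N) (Fin N) F) (hY : Y ∈ utAlg F (fatR blk P)) (i m : Fin l) (him : P i m) :
    rkB blk (trunc (fatR blk P) (g * Y * h)) (i+1) m = rkB blk Y (i+1) m := by
  apply le_antisymm (rkB_trunc_le blk P hP hg hh Y i m him)
  obtain ⟨g', h', hg', hh', e⟩ := orb_symm blk P hP hg hh Y hY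
  calc rkB blk Y (i+1) m = rkB blk (trunc (fatR blk P) (g' * trunc (fatR blk P) (g * Y * h) * h')) (i+1) m :=
      congrArg (fun Z => rkB blk Z (i+1) m) e
    _ ≤ _ := rkB_trunc_le blk P hP hg' hh' _ i m him

end

section
variable {F : Type} [Field F] {N l : ℕ} (blk : Fin N → Fin l)

def mkT (T : Finset (Fin N × Fin N)) (M : Matrix (Fin N) (Fin N) F) :
    Matrix (Fin N) (Fin N) F := fun a b => if (a, b) ∈ T then M a b else 0

lemma mkT_mem {T : Finset (Fin N × Fin N)} {M : Matrix (Fin N) (Fin N) F} {a b : Fin N}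
    (h : (a, b) ∈ T) : mkT T M a b = M a b := if_pos h

lemma mkT_notMem {T : Finset (Fin N × Fin N)} {M : Matrix (Fin N) (Fin N) F} {a b : Fin N}
    (h : (a, b) ∉ T) : mkT T M a b = 0 := if_neg h

lemma mkT_step (T : Finset (Fin N × Fin N)) (Y Y' : Matrix (Fin N) (Fin N) F) (r s : Fin N)
    (h : IsPPM (mkT T Y)) (hY : ∀ a b, (a, b) ∈ T → Y' a b = Y a b) (h0 : Y' r s = 0) :
    IsPPM (mkT (insert (r, s) T) Y') := by
  have : mkT (insert (r, s) T) Y' = mkT T Y := by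
    ext a b
    by_cases hab : (a, b) ∈ T
    · rw [mkT_mem hab, mkT_mem (Finset.mem_insert_of_mem hab), hY a b hab]
    · rw [mkT_notMem hab]
      by_cases he : (a, b) = (r, s)
      · rw [mkT_mem (by rw [he]; exact Finset.mem_insert_self _ _)]
        simp only [Prod.mk.injEq] at he
        rw [he.1, he.2, h0]
      · rw [mkT_notMem]
        rw [Finset.mem_insert]; tauto
  rw [this]; exact h

lemma mkT_step1 (T : Finset (Fin N × Fin N)) (Y Y' : Matrix (Fin N) (Fin N) F) (r s : Fin N)
    (h : IsPPM (mkT T Y)) (hY : ∀ a b, (a, b) ∈ T → Y' a b = Y a b) (h0 : Y' r s = 1)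
    (hr : ∀ b, mkT T Y r b = 0) (hs : ∀ a, mkT T Y a s = 0) :
    IsPPM (mkT (insert (r, s) T) Y') := by
  have key : ∀ a b, mkT (insert (r, s) T) Y' a b = if a = r ∧ b = s then 1 else mkT T Y a b := by
    intro a b
    split_ifs with he
    · rw [mkT_mem (by rw [he.1, he.2]; exact Finset.mem_insert_self _ _), he.1, he.2, h0]
    · by_cases hab : (a, b) ∈ T
      · rw [mkT_mem hab, mkT_mem (Finset.mem_insert_of_mem hab), hY a b hab]
      · rw [mkT_notMem hab, mkT_notMem]
        rw [Finset.mem_insert, Prod.mk.injEq]; tauto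
  refine ⟨?_, ?_, ?_⟩
  · intro a b
    rw [key]
    split_ifs
    · exact Or.inr rfl
    · exact h.1 a b
  · intro a b c h1 h2
    rw [key] at h1 h2
    by_cases ha : a = r
    · subst ha
      split_ifs at h1 h2 with e1 e2 e3
      · exact e1.2.trans e2.2.symm
      · exact absurd (hr c) h2
      · exact absurd (hr b) h1
      · exact absurd (hr b) h1
    · rw [if_neg (by tauto)] at h1 h2
      exact h.2.1 a b c h1 h2
  · intro a b c h1 h2
    rw [key] at h1 h2
    by_cases hc : c = s
    · subst hc
      split_ifs at h1 h2 with e1 e2 e3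
      · exact e1.1.trans e2.1.symm
      · exact absurd (hs b) h2
      · exact absurd (hs a) h1
      · exact absurd (hs a) h1
    · rw [if_neg (by tauto)] at h1 h2
      exact h.2.2 a b c h1 h2

lemma LowB_transvection (hblk : Monotone blk) (a b : Fin N) (hab : b < a) (c : F) :
    LowB blk (Matrix.transvection a b c) := by
  refine ⟨(Matrix.isUnit_iff_isUnit_det _).2 ?_, ?_⟩
  · rw [Matrix.det_transvection_of_ne _ _ hab.ne']; exact isUnit_one
  · intro r s h
    have hrs : r < s := by
      by_contra h'
      exact absurd (hblk (not_lt.1 h')) (not_le.2 h)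
    simp only [Matrix.transvection, Matrix.add_apply]
    rw [Matrix.one_apply_ne hrs.ne, Matrix.single_apply_of_ne, add_zero]
    rintro ⟨rfl, rfl⟩
    exact absurd hab (not_lt.2 hrs.le)

lemma LowB_diagonal (d : Fin N → F) (hd : ∀ i, d i ≠ 0) : LowB blk (Matrix.diagonal d) := by
  refine ⟨(Matrix.isUnit_iff_isUnit_det _).2 ?_, ?_⟩
  · rw [Matrix.det_diagonal]; exact isUnit_iff_ne_zero.2 (Finset.prod_ne_zero_iff.2 fun i _ => hd i)
  · intro r s h
    exact Matrix.diagonal_apply_ne _ (by rintro rfl; exact lt_irrefl _ h)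

lemma elimB (hblk : Monotone blk) (Z : Matrix (Fin N) (Fin N) F) (T : Finset (Fin N × Fin N))
    (hT : IsUpB T) : ∃ g h, LowB blk g ∧ LowB blk h ∧ IsPPM (mkT T (g * Z * h)) := by
  refine IsUpB_induction (fun T => ∃ g h, LowB blk g ∧ LowB blk h ∧ IsPPM (mkT T (g * Z * h)))
    ?_ ?_ _ T rfl hT
  · refine ⟨1, 1, LowB_one blk, LowB_one blk, ?_⟩
    simp [IsPPM, mkT]
  · rintro T ⟨r, s⟩ hT hrs hI ⟨g, h, hg, hh, hp⟩
    have f1 : ∀ a b, (a, b) ∈ T → r ≤ a → s < b := by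
      intro a b hab hra
      by_contra hb
      exact hrs (hT a b r s hab hra (not_lt.1 hb))
    have f2 : ∀ a b, (a, b) ∈ T → b ≤ s → a < r := by
      intro a b hab hra
      by_contra hb
      exact hrs (hT a b r s hab (not_lt.1 hb) hra)
    have f3 : ∀ b, s < b → (r, b) ∈ T := by
      intro b hb
      have := hI r s r b (Finset.mem_insert_self _ _) le_rfl hb.le
      rw [Finset.mem_insert, Prod.mk.injEq] at this
      rcases this with h | h
      · exact absurd h.2 hb.ne'
      · exact h
    have f4 : ∀ a, a < r → (a, s) ∈ T := by
      intro b hb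
      have := hI r s b s (Finset.mem_insert_self _ _) hb.le le_rfl
      rw [Finset.mem_insert, Prod.mk.injEq] at this
      rcases this with h | h
      · exact absurd h.1 hb.ne
      · exact h
    set Y := g * Z * h with hYd
    by_cases c1 : ∃ b, s < b ∧ Y r b ≠ 0
    · obtain ⟨b, hb, hne⟩ := c1
      have h1 : Y r b = 1 := by
        have := hp.1 r b
        rw [mkT_mem (f3 b hb)] at this
        exact this.resolve_left hne
      refine ⟨g, h * Matrix.transvection b s (-(Y r s)), hg,
        LowB_mul blk hh (LowB_transvection blk hblk b s hb _), ?_⟩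
      rw [← Matrix.mul_assoc, ← hYd]
      apply mkT_step T Y _ r s hp
      · intro u v huv
        by_cases hv : v = s
        · subst hv
          have hu := f2 u v huv le_rfl
          have hub : (u, b) ∈ T := hT u v u b huv le_rfl hb.le
          have : Y u b = 0 := by
            by_contra hc
            refine hu.ne (hp.2.2 u r b ?_ ?_)
            · rw [mkT_mem hub]; exact hc
            · rw [mkT_mem (f3 b hb)]; exact hne
          rw [Matrix.mul_transvection_apply_same, this, mul_zero, add_zero]
        · rw [Matrix.mul_transvection_apply_of_ne _ _ _ _ hv]
      · rw [Matrix.mul_transvection_apply_same, h1]; ring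
    by_cases c2 : ∃ a, a < r ∧ Y a s ≠ 0
    · obtain ⟨a, ha, hne⟩ := c2
      have h1 : Y a s = 1 := by
        have := hp.1 a s
        rw [mkT_mem (f4 a ha)] at this
        exact this.resolve_left hne
      refine ⟨Matrix.transvection r a (-(Y r s)) * g, h,
        LowB_mul blk (LowB_transvection blk hblk r a ha _) hg, hh, ?_⟩
      rw [Matrix.mul_assoc, Matrix.mul_assoc, ← Matrix.mul_assoc g, ← hYd]
      apply mkT_step T Y _ r s hp
      · intro u v huv
        by_cases hu : u = r
        · subst hu
          have hv := f1 u v huv le_rfl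
          have hub : (a, v) ∈ T := hT u v a v huv ha.le le_rfl
          have : Y a v = 0 := by
            by_contra hc
            refine hv.ne (hp.2.1 a s v ?_ ?_)
            · rw [mkT_mem (f4 a ha)]; exact hne
            · rw [mkT_mem hub]; exact hc
          rw [Matrix.transvection_mul_apply_same, this, mul_zero, add_zero]
        · rw [Matrix.transvection_mul_apply_of_ne _ _ _ _ hu]
      · rw [Matrix.transvection_mul_apply_same, h1]; ring
    push Not at c1 c2
    by_cases hx : Y r s = 0
    · exact ⟨g, h, hg, hh, mkT_step T Y Y r s hp (fun _ _ _ => rfl) hx⟩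
    refine ⟨Matrix.diagonal (fun i => if i = r then (Y r s)⁻¹ else 1) * g, h,
      LowB_mul blk (LowB_diagonal blk _ ?_) hg, hh, ?_⟩
    · intro i
      split_ifs
      · exact inv_ne_zero hx
      · exact one_ne_zero
    rw [Matrix.mul_assoc, Matrix.mul_assoc, ← Matrix.mul_assoc g, ← hYd]
    apply mkT_step1 T Y _ r s hp
    · intro u v huv
      rw [Matrix.diagonal_mul]
      split_ifs with hu
      · subst hu
        rw [c1 v (f1 u v huv le_rfl), mul_zero]
      · rw [one_mul]
    · rw [Matrix.diagonal_mul, if_pos rfl, inv_mul_cancel₀ hx]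
    · intro b
      by_cases hb : (r, b) ∈ T
      · rw [mkT_mem hb, c1 b (f1 r b hb le_rfl)]
      · exact mkT_notMem hb
    · intro a
      by_cases hb : (a, s) ∈ T
      · rw [mkT_mem hb, c2 a (f2 a s hb le_rfl)]
      · exact mkT_notMem hb

lemma elim_trunc (hblk : Monotone blk) (P : Fin l → Fin l → Prop) (hP : NormB P)
    (Z : Matrix (Fin N) (Fin N) F) :
    ∃ g h, LowB blk g ∧ LowB blk h ∧ IsPPM (trunc (fatR blk P) (g * Z * h)) := by
  obtain ⟨g, h, hg, hh, hp⟩ := elimB blk hblk Z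
    (Finset.univ.filter fun p : Fin N × Fin N => P (blk p.1) (blk p.2)) (by
      intro i m i' m' him hi hm
      have := (Finset.mem_filter.1 him).2
      exact Finset.mem_filter.2 ⟨Finset.mem_univ _, hP _ _ _ _ this (hblk hi) (hblk hm)⟩)
  refine ⟨g, h, hg, hh, ?_⟩
  convert hp using 1
  ext a b
  by_cases hab : P (blk a) (blk b)
  · rw [mkT_mem (Finset.mem_filter.2 ⟨Finset.mem_univ _, hab⟩)]; exact if_pos hab
  · rw [mkT_notMem (fun h' => hab (Finset.mem_filter.1 h').2)]; exact if_neg hab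

/-- extension of a block preserving partial bijection -/
lemma extB (p p' : Fin N → Prop) (e : {r // p r} ≃ {r // p' r})
    (he : ∀ x, blk (e x).1 = blk x.1) :
    ∃ σ : Equiv.Perm (Fin N), (∀ r, blk (σ r) = blk r) ∧ ∀ x, σ x.1 = (e x).1 := by
  have hc : ∀ i, Nonempty ({x : {r // ¬ p r} // blk x.1 = i} ≃ {x : {r // ¬ p' r} // blk x.1 = i}) := by
    intro i
    have h1 : ∀ p : Fin N → Prop, Fintype.card {x : {r // ¬ p r} // blk x.1 = i} +
        Fintype.card {x : {r // p r} // blk x.1 = i} =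
        Fintype.card {x // blk x = i} := by
      intro p
      rw [Fintype.card_congr (Equiv.subtypeSubtypeEquivSubtypeInter (fun r => ¬ p r) (fun r => blk r = i)),
        Fintype.card_congr (Equiv.subtypeSubtypeEquivSubtypeInter p (fun r => blk r = i)),
        Fintype.card_subtype, Fintype.card_subtype, Fintype.card_subtype,
        ← Finset.card_filter_add_card_filter_not (s := Finset.univ.filter fun x => blk x = i) p,
        Finset.filter_filter, Finset.filter_filter, add_comm]
      simp only [and_comm]
    have h2 : Fintype.card {x : {r // p r} // blk x.1 = i} =
        Fintype.card {x : {r // p' r} // blk x.1 = i} :=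
      Fintype.card_congr (e.subtypeEquiv fun a => by rw [he])
    apply Fintype.card_eq.1
    have := h1 p
    have := h1 p'
    omega
  let f : {r // ¬ p r} ≃ {r // ¬ p' r} :=
    Equiv.ofFiberEquiv (f := fun x => blk x.1) (g := fun x => blk x.1) fun i => (hc i).some
  have hf : ∀ x, blk (f x).1 = blk x.1 := fun x =>
    Equiv.ofFiberEquiv_map (f := fun x : {r // ¬ p r} => blk x.1)
      (g := fun x : {r // ¬ p' r} => blk x.1) (fun i => (hc i).some) x
  let σ : Equiv.Perm (Fin N) :=
    (Equiv.sumCompl p).symm.trans ((Equiv.sumCongr e f).trans (Equiv.sumCompl p'))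
  have h1 : ∀ x : {r // p r}, σ x.1 = (e x).1 := by
    intro x
    simp [σ, Equiv.sumCompl_symm_apply_of_pos x.2]
  have h2 : ∀ x : {r // ¬ p r}, σ x.1 = (f x).1 := by
    intro x
    simp [σ, Equiv.sumCompl_symm_apply_of_neg x.2]
  refine ⟨σ, ?_, h1⟩
  intro r
  by_cases hr : p r
  · rw [h1 ⟨r, hr⟩, he]
  · rw [h2 ⟨r, hr⟩, hf]

end

section
variable {F : Type} [Field F] {N l : ℕ} (blk : Fin N → Fin l)

lemma permB (M M' : Matrix (Fin N) (Fin N) F) (hM : IsPPM M) (hM' : IsPPM M')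
    (hc : ∀ i k, cntB blk M i k = cntB blk M' i k) :
    ∃ σ τ : Equiv.Perm (Fin N), (∀ r, blk (σ r) = blk r) ∧ (∀ r, blk (τ r) = blk r) ∧
      ∀ r s, M r s = M' (σ r) (τ s) := by
  have hfib : ∀ (M : Matrix (Fin N) (Fin N) F) (c : Fin l × Fin l),
      Fintype.card {x : {p : Fin N × Fin N // M p.1 p.2 ≠ 0} // (blk x.1.1, blk x.1.2) = c} =
      cntB blk M c.1 c.2 := by
    intro M c
    rw [Fintype.card_congr (Equiv.subtypeSubtypeEquivSubtypeInter
      (fun p : Fin N × Fin N => M p.1 p.2 ≠ 0) (fun p => (blk p.1, blk p.2) = c)),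
      Fintype.card_subtype]
    unfold cntB
    congr 1
    ext ⟨a, b⟩
    simp only [Finset.mem_filter, Finset.mem_univ, true_and, Prod.ext_iff]
  have hc' : ∀ c, Nonempty
      ({x : {p : Fin N × Fin N // M p.1 p.2 ≠ 0} // (blk x.1.1, blk x.1.2) = c} ≃
       {x : {p : Fin N × Fin N // M' p.1 p.2 ≠ 0} // (blk x.1.1, blk x.1.2) = c}) := by
    intro c
    apply Fintype.card_eq.1
    rw [hfib, hfib, hc]
  let E : {p : Fin N × Fin N // M p.1 p.2 ≠ 0} ≃ {p : Fin N × Fin N // M' p.1 p.2 ≠ 0} :=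
    Equiv.ofFiberEquiv (f := fun x => (blk x.1.1, blk x.1.2))
      (g := fun x => (blk x.1.1, blk x.1.2)) fun c => (hc' c).some
  have hE : ∀ x, (blk (E x).1.1, blk (E x).1.2) = (blk x.1.1, blk x.1.2) := fun x =>
    Equiv.ofFiberEquiv_map (f := fun x : {p : Fin N × Fin N // M p.1 p.2 ≠ 0} =>
      (blk x.1.1, blk x.1.2))
      (g := fun x : {p : Fin N × Fin N // M' p.1 p.2 ≠ 0} => (blk x.1.1, blk x.1.2))
      (fun c => (hc' c).some) x
  have hrow : ∀ M : Matrix (Fin N) (Fin N) F, IsPPM M →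
      ∃ e : {p : Fin N × Fin N // M p.1 p.2 ≠ 0} ≃ {r // ∃ s, M r s ≠ 0},
        ∀ x, (e x).1 = x.1.1 := by
    intro M hM
    refine ⟨Equiv.ofBijective (fun x => ⟨x.1.1, x.1.2, x.2⟩) ⟨?_, ?_⟩, fun x => rfl⟩
    · rintro ⟨⟨a, b⟩, h⟩ ⟨⟨a', b'⟩, h'⟩ e
      simp only [Subtype.mk.injEq] at e
      subst e
      have := hM.2.1 a b b' h h'
      subst this
      rfl
    · rintro ⟨r, s, h⟩
      exact ⟨⟨(r, s), h⟩, rfl⟩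
  have hcol : ∀ M : Matrix (Fin N) (Fin N) F, IsPPM M →
      ∃ e : {p : Fin N × Fin N // M p.1 p.2 ≠ 0} ≃ {s // ∃ r, M r s ≠ 0},
        ∀ x, (e x).1 = x.1.2 := by
    intro M hM
    refine ⟨Equiv.ofBijective (fun x => ⟨x.1.2, x.1.1, x.2⟩) ⟨?_, ?_⟩, fun x => rfl⟩
    · rintro ⟨⟨a, b⟩, h⟩ ⟨⟨a', b'⟩, h'⟩ e
      simp only [Subtype.mk.injEq] at e
      subst e
      have := hM.2.2 a a' b h h'
      subst this
      rfl
    · rintro ⟨r, s, h⟩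
      exact ⟨⟨(s, r), h⟩, rfl⟩
  obtain ⟨eR, heR⟩ := hrow M hM
  obtain ⟨eR', heR'⟩ := hrow M' hM'
  obtain ⟨eC, heC⟩ := hcol M hM
  obtain ⟨eC', heC'⟩ := hcol M' hM'
  obtain ⟨σ, hσ, hσ'⟩ := extB blk _ _ (eR.symm.trans (E.trans eR')) (by
    intro x
    obtain ⟨y, rfl⟩ := eR.surjective x
    simp only [Equiv.trans_apply, Equiv.symm_apply_apply, heR, heR']
    exact congrArg Prod.fst (hE y))
  obtain ⟨τ, hτ, hτ'⟩ := extB blk _ _ (eC.symm.trans (E.trans eC')) (by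
    intro x
    obtain ⟨y, rfl⟩ := eC.surjective x
    simp only [Equiv.trans_apply, Equiv.symm_apply_apply, heC, heC']
    exact congrArg Prod.snd (hE y))
  have kσ : ∀ x, σ x.1.1 = (E x).1.1 := by
    intro x
    have := hσ' (eR x)
    simpa only [Equiv.trans_apply, Equiv.symm_apply_apply, heR, heR'] using this
  have kτ : ∀ x, τ x.1.2 = (E x).1.2 := by
    intro x
    have := hτ' (eC x)
    simpa only [Equiv.trans_apply, Equiv.symm_apply_apply, heC, heC'] using this
  refine ⟨σ, τ, hσ, hτ, ?_⟩
  intro r s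
  by_cases h : M r s = 0
  · rw [h]
    by_contra h'
    obtain ⟨x, hx⟩ := E.surjective ⟨(σ r, τ s), Ne.symm h'⟩
    have e1 := kσ x
    have e2 := kτ x
    rw [hx] at e1 e2
    have e1 := σ.injective e1
    have e2 := τ.injective e2
    apply x.2
    rw [e1, e2, h]
  · have e1 := kσ ⟨(r, s), h⟩
    have e2 := kτ ⟨(r, s), h⟩
    simp only at e1 e2
    rw [e1, e2, (hM.1 r s).resolve_left h, (hM'.1 _ _).resolve_left (E ⟨(r, s), h⟩).2]

lemma permB_mat (M M' : Matrix (Fin N) (Fin N) F) (hM : IsPPM M) (hM' : IsPPM M')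
    (hc : ∀ i k, cntB blk M i k = cntB blk M' i k) :
    ∃ g h, LowB blk g ∧ LowB blk h ∧ M = g * M' * h := by
  obtain ⟨σ, τ, hσ, hτ, e⟩ := permB blk M M' hM hM' hc
  refine ⟨(1 : Matrix (Fin N) (Fin N) F).submatrix σ (Equiv.refl _),
    (1 : Matrix (Fin N) (Fin N) F).submatrix (Equiv.refl _) τ, ⟨?_, ?_⟩, ⟨?_, ?_⟩, ?_⟩
  · rw [Matrix.isUnit_submatrix_equiv]; exact isUnit_one
  · intro r s h
    rw [Matrix.submatrix_apply, Matrix.one_apply_ne]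
    intro h'
    have := hσ r
    rw [h'] at this
    exact h.ne this.symm
  · rw [Matrix.isUnit_submatrix_equiv]; exact isUnit_one
  · intro r s h
    rw [Matrix.submatrix_apply, Matrix.one_apply_ne]
    intro h'
    have := hτ s
    rw [← h'] at this
    exact h.ne this
  · ext r s
    simp [Matrix.mul_apply, Matrix.one_apply, e r s]

lemma NormB_of (P : Fin l → Fin l → Prop) (hP : IsNormalChainSubposet P) : NormB P := by
  intro i m i' m' h hi hm
  have h1 : P i' m := by
    rcases hi.lt_or_eq with h' | rfl
    · exact hP.2.1 _ _ _ h h'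
    · exact h
  rcases hm.lt_or_eq with h' | rfl
  · exact hP.2.2 _ _ _ h1 h'
  · exact h1

lemma cntB_off (P : Fin l → Fin l → Prop) (M : Matrix (Fin N) (Fin N) F)
    (hM : M ∈ utAlg F (fatR blk P)) (i k : Fin l) (h : ¬ P i k) : cntB blk M i k = 0 := by
  unfold cntB
  rw [Finset.card_eq_zero, Finset.filter_eq_empty_iff]
  rintro ⟨a, b⟩ _ ⟨h1, h2, h3⟩
  simp only at h1 h2 h3
  apply h1
  apply hM
  unfold fatR
  rw [h2, h3]; exact h

lemma trunc_ut (P : Fin l → Fin l → Prop) (M : Matrix (Fin N) (Fin N) F) :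
    trunc (fatR blk P) M ∈ utAlg F (fatR blk P) := fun _ _ h => if_neg h

lemma trunc_self (P : Fin l → Fin l → Prop) (M : Matrix (Fin N) (Fin N) F)
    (hM : M ∈ utAlg F (fatR blk P)) : trunc (fatR blk P) M = M := by
  ext r s
  simp only [trunc]
  split_ifs with h
  · rfl
  · exact (hM r s h).symm

lemma orb_eq_SB (hblk : Monotone blk) (P : Fin l → Fin l → Prop) (hP : NormB P)
    (lam : Fin l → Fin l → ℕ) (hlam : ∀ i j, ¬ P i j → lam i j = 0)
    (Λ : Matrix (Fin N) (Fin N) F)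
    (hΛ1 : Λ ∈ utAlg F (fatR blk P)) (hΛ2 : IsPPM Λ)
    (hΛ3 : ∀ i j, P i j → blockRank blk Λ i j = lam i j) (Z : Matrix (Fin N) (Fin N) F) :
    Z ∈ orb F blk (fatR blk P) Λ ↔
      SB blk lam (Finset.univ.filter fun p : Fin l × Fin l => P p.1 p.2) Z := by
  have hcnt : cntB blk Λ = lam := by
    funext i k
    by_cases h : P i k
    · rw [← cntB_blockRank blk Λ hΛ2, hΛ3 i k h]
    · rw [cntB_off blk P Λ hΛ1 i k h, hlam i k h]
  have hmem : ∀ i k, (i, k) ∈ (Finset.univ.filter fun p : Fin l × Fin l => P p.1 p.2) ↔ P i k := by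
    intro i k; simp
  constructor
  · rintro ⟨g, h, hg, hh, hg', hh', rfl⟩
    refine ⟨?_, ?_⟩
    · intro r s hrs
      rw [hmem] at hrs
      exact trunc_ut blk P _ r s hrs
    · intro i m him
      rw [hmem] at him
      rw [rkB_trunc blk P hP ⟨hg, hg'⟩ ⟨hh, hh'⟩ Λ hΛ1 i m him, rkB_ppm blk Λ hΛ2, hcnt]
  · intro hZ
    have hZu : Z ∈ utAlg F (fatR blk P) := by
      intro r s h
      apply hZ.1
      rw [hmem]; exact h
    obtain ⟨g, h, hg, hh, hp⟩ := elim_trunc blk hblk P hP Z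
    set Λ' := trunc (fatR blk P) (g * Z * h) with hΛ'
    have hut : Λ' ∈ utAlg F (fatR blk P) := trunc_ut blk P _
    have hrk : SB blk lam (Finset.univ.filter fun p : Fin l × Fin l => P p.1 p.2) Λ' := by
      refine ⟨?_, ?_⟩
      · intro r s hrs
        rw [hmem] at hrs
        exact hut r s hrs
      · intro i m him
        rw [← hZ.2 i m him]
        rw [hmem] at him
        exact rkB_trunc blk P hP hg hh Z hZu i m him
    have hc' : ∀ i k, cntB blk Λ' i k = cntB blk Λ i k := by
      intro i k
      rw [hcnt]
      by_cases hik : P i k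
      · have e1 := rhoB_entry (cntB blk Λ') i k
        have e2 := rhoB_entry lam i k
        have key : ∀ a c : ℕ, a ≤ i + 1 → (k : ℕ) ≤ c → rhoB (cntB blk Λ') a c = rhoB lam a c := by
          intro a c ha hc
          rw [← rkB_ppm blk Λ' hp]
          apply SB_rk blk lam _ Λ' hrk
          · intro j m hj hm
            rw [hmem]
            apply hP _ _ _ _ hik
            · rw [Fin.le_def]; omega
            · rw [Fin.le_def]; omega
          · have := i.2; omega
        rw [key _ _ (by omega) (by omega), key _ _ (by omega) (by omega),
          key _ _ (by omega) (by omega), key _ _ (by omega) (by omega)] at e1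
        omega
      · rw [cntB_off blk P Λ' hut i k hik, hlam i k hik]
    obtain ⟨g1, h1, hg1, hh1, e⟩ := permB_mat blk Λ' Λ hp hΛ2 hc'
    obtain ⟨g2, h2, hg2, hh2, e2⟩ := orb_symm blk P hP hg hh Z hZu
    rw [← hΛ', e] at e2
    have hG := LowB_mul blk hg2 hg1
    have hH := LowB_mul blk hh1 hh2
    refine ⟨g2 * g1, h1 * h2, hG.1, hH.1, hG.2, hH.2, ?_⟩
    rw [e2]
    congr 1
    simp only [Matrix.mul_assoc]

end

section
variable {l : ℕ}

def bB (lam : Fin l → Fin l → ℕ) (j k : Fin l) : ℕ :=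
  ∑ i ∈ Finset.univ.filter (fun i => i < j), lam i k

def cB (lam : Fin l → Fin l → ℕ) (j k : Fin l) : ℕ :=
  ∑ m ∈ Finset.univ.filter (fun m => k < m), lam j m

lemma bDimL_eq (P : Fin l → Fin l → Prop) (hP : NormB P) (β : Fin l → ℕ)
    (lam : Fin l → Fin l → ℕ) :
    bDimL P β lam = ∑ p ∈ Finset.univ.filter (fun p : Fin l × Fin l => P p.1 p.2),
      cB lam p.1 p.2 * β p.2 := by
  unfold bDimL cB
  rw [Finset.sum_filter, Finset.sum_filter, Fintype.sum_prod_type, Fintype.sum_prod_type]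
  apply Finset.sum_congr rfl; intro i _
  rw [Fintype.sum_prod_type]
  apply Finset.sum_congr rfl; intro j _
  simp only
  by_cases h : P i j
  · rw [if_pos h, Finset.sum_filter, Finset.sum_mul]
    apply Finset.sum_congr rfl; intro k _
    by_cases hk : j < k
    · rw [if_pos ⟨h, hk, hP _ _ _ _ h le_rfl hk.le⟩, if_pos hk]
    · rw [if_neg (by tauto), if_neg hk, zero_mul]
  · rw [if_neg h]
    apply Finset.sum_eq_zero; intro k _
    rw [if_neg (by tauto)]

lemma bDimR_eq (P : Fin l → Fin l → Prop) (hP : NormB P) (β : Fin l → ℕ)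
    (lam : Fin l → Fin l → ℕ) :
    bDimR P β lam = ∑ p ∈ Finset.univ.filter (fun p : Fin l × Fin l => P p.1 p.2),
      β p.1 * bB lam p.1 p.2 := by
  unfold bDimR bB
  rw [Finset.sum_filter, Finset.sum_filter, Fintype.sum_prod_type, Finset.sum_comm]
  apply Finset.sum_congr rfl; rintro ⟨j, k⟩ _
  simp only
  by_cases h : P j k
  · rw [if_pos h, Finset.sum_filter, Finset.mul_sum]
    apply Finset.sum_congr rfl; intro i _
    by_cases hk : i < j
    · rw [if_pos ⟨hk, h, hP _ _ _ _ h hk.le le_rfl⟩, if_pos hk, mul_comm]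
    · rw [if_neg (by tauto), if_neg hk, mul_zero]
  · rw [if_neg h]
    apply Finset.sum_eq_zero; intro k _
    rw [if_neg (by tauto)]

lemma bCrs_eq (P : Fin l → Fin l → Prop) (hP : NormB P)
    (lam : Fin l → Fin l → ℕ) :
    bCrs P lam = ∑ p ∈ Finset.univ.filter (fun p : Fin l × Fin l => P p.1 p.2),
      cB lam p.1 p.2 * bB lam p.1 p.2 := by
  unfold bCrs bB cB
  rw [Finset.sum_filter, Finset.sum_filter, Fintype.sum_prod_type, Finset.sum_comm,
    Fintype.sum_prod_type, Fintype.sum_prod_type]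
  apply Finset.sum_congr rfl; intro j _
  rw [Fintype.sum_prod_type]
  apply Finset.sum_congr rfl; intro k _
  simp only
  by_cases h : P j k
  · rw [if_pos h, Finset.sum_filter, Finset.sum_filter, Finset.sum_mul]
    apply Finset.sum_congr rfl; intro m _
    rw [Finset.mul_sum]
    apply Finset.sum_congr rfl; intro i _
    by_cases hi : i < j
    · by_cases hm : k < m
      · rw [if_pos ⟨hi, h, hm, hP _ _ _ _ h hi.le le_rfl, hP _ _ _ _ h le_rfl hm.le⟩, if_pos hi,
          if_pos hm, mul_comm]
      · rw [if_neg (by tauto), if_neg hm, zero_mul]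
    · rw [if_neg (by tauto), if_neg hi, mul_zero]
  · rw [if_neg h]
    apply Finset.sum_eq_zero; intro k _
    apply Finset.sum_eq_zero; intro k _
    rw [if_neg (by tauto)]

lemma bB_if (lam : Fin l → Fin l → ℕ) (j k : Fin l) :
    (∑ i : Fin l, if (i : ℕ) < j then lam i k else 0) = bB lam j k := by
  unfold bB
  rw [Finset.sum_filter]
  rfl

lemma cB_if (lam : Fin l → Fin l → ℕ) (j k : Fin l) :
    (∑ m : Fin l, if (k : ℕ) + 1 ≤ m then lam j m else 0) = cB lam j k := by
  unfold cB
  rw [Finset.sum_filter]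
  rfl

lemma bB_le (P : Fin l → Fin l → Prop) (hP : NormB P) (β : Fin l → ℕ)
    (lam : Fin l → Fin l → ℕ) (hlam : Tmem P β lam) (j k : Fin l) (h : P j k) :
    bB lam j k + lam j k ≤ β k := by
  refine le_trans ?_ (hlam.2 k).1
  unfold bB
  rw [add_comm, ← Finset.sum_insert (s := Finset.univ.filter (fun i => i < j))
    (f := fun i => lam i k) (a := j) (by simp)]
  apply Finset.sum_le_sum_of_subset
  intro i hi
  rw [Finset.mem_insert, Finset.mem_filter] at hi
  refine Finset.mem_filter.2 ⟨Finset.mem_univ _, ?_⟩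
  rcases hi with rfl | hi
  · exact h
  · exact hP _ _ _ _ h hi.2.le le_rfl

lemma cB_le (P : Fin l → Fin l → Prop) (hP : NormB P) (β : Fin l → ℕ)
    (lam : Fin l → Fin l → ℕ) (hlam : Tmem P β lam) (j k : Fin l) (h : P j k) :
    cB lam j k + lam j k ≤ β j := by
  refine le_trans ?_ (hlam.2 j).2
  unfold cB
  rw [add_comm, ← Finset.sum_insert (s := Finset.univ.filter (fun m => k < m))
    (f := fun m => lam j m) (a := k) (by simp)]
  apply Finset.sum_le_sum_of_subset
  intro i hi
  rw [Finset.mem_insert, Finset.mem_filter] at hi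
  refine Finset.mem_filter.2 ⟨Finset.mem_univ _, ?_⟩
  rcases hi with rfl | hi
  · exact h
  · exact hP _ _ _ _ h le_rfl hi.2.le

end

/-- the size of the orbit `O(Λ)` (equivalently, the supercharacter degree)
is `q^{dim_L(λ)+dim_R(λ)−crs(λ)} ∏_{j P l} |GL_{λ(j,l)}|
[β_j − Σ_{m>l} λ(j,m) choose λ(j,l)]_q [β_l − Σ_{i<j} λ(i,l) choose λ(j,l)]_q`. -/
theorem stmt_15 (F : Type) [Field F] [Fintype F] (ψ : F → ℂ)
    (hψadd : ∀ a b, ψ (a + b) = ψ a * ψ b) (hψ0 : ψ 0 = 1) (hψnt : ∃ a, ψ a ≠ 1)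
    (N l : ℕ) (β : Fin l → ℕ) (blk : Fin N → Fin l)
    (hβ : ∀ i, 0 < β i) (hblk : Monotone blk)
    (hcard : ∀ i, (Finset.univ.filter fun r => blk r = i).card = β i)
    (P : Fin l → Fin l → Prop) (hP : IsNormalChainSubposet P)
    (G : ℕ → ℕ → ℕ)
    (hG1 : ∀ a k, k ≤ a →
      G a k * ∏ i ∈ Finset.range k, (Fintype.card F ^ (i + 1) - 1) =
        ∏ i ∈ Finset.range k, (Fintype.card F ^ (a - k + i + 1) - 1))
    (hG2 : ∀ a k, a < k → G a k = 0)
    (lam : Fin l → Fin l → ℕ) (hlam : Tmem P β lam)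
    (Λ : Matrix (Fin N) (Fin N) F)
    (hΛ1 : Λ ∈ utAlg F (fatR blk P)) (hΛ2 : IsPPM Λ)
    (hΛ3 : ∀ i j, P i j → blockRank blk Λ i j = lam i j) :
    (Set.ncard (orb F blk (fatR blk P) Λ) : ℂ) =
      (Fintype.card F : ℂ) ^ (bDimL P β lam + bDimR P β lam) /
          (Fintype.card F : ℂ) ^ bCrs P lam *
        ∏ p ∈ Finset.univ.filter (fun p : Fin l × Fin l => P p.1 p.2),
          ((GLcard F (lam p.1 p.2) : ℂ) *
            (G (β p.1 - ∑ m ∈ Finset.univ.filter (fun m => p.2 < m), lam p.1 m)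
              (lam p.1 p.2) : ℂ) *
            (G (β p.2 - ∑ i ∈ Finset.univ.filter (fun i => i < p.1), lam i p.2)
              (lam p.1 p.2) : ℂ)) ∧
    chi ψ blk (fatR blk P) Λ 1 = (Set.ncard (orb F blk (fatR blk P) Λ) : ℂ) := by
  have hN : NormB P := NormB_of P hP
  have hq : 2 ≤ Fintype.card F := Fintype.one_lt_card
  have hq0 : (Fintype.card F : ℂ) ≠ 0 := by
    have : Fintype.card F ≠ 0 := by omega
    exact_mod_cast this
  constructor
  · set D := Finset.univ.filter (fun p : Fin l × Fin l => P p.1 p.2) with hD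
    have hDm : ∀ p, p ∈ D → P p.1 p.2 := fun p hp => (Finset.mem_filter.1 hp).2
    have hDup : IsUpB D := by
      intro i m i' m' h hi hm
      exact Finset.mem_filter.2 ⟨Finset.mem_univ _, hN _ _ _ _ (hDm _ h) hi hm⟩
    have horb : orb F blk (fatR blk P) Λ =
        ((Finset.univ.filter (fun Z : Matrix (Fin N) (Fin N) F => SB blk lam D Z) :
          Finset (Matrix (Fin N) (Fin N) F)) : Set (Matrix (Fin N) (Fin N) F)) := by
      ext Z
      rw [orb_eq_SB blk hblk P hN lam hlam.1 Λ hΛ1 hΛ2 hΛ3 Z, Finset.mem_coe, Finset.mem_filter]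
      exact ⟨fun h => ⟨Finset.mem_univ _, h⟩, fun h => h.2⟩
    rw [horb, Set.ncard_coe_finset, SB_card blk β hcard lam _ D rfl hDup, Nat.cast_prod]
    have hw : ∀ p ∈ D, ((wB (Fintype.card F) β lam p.1 p.2 : ℕ) : ℂ) =
        (Fintype.card F : ℂ) ^ (β p.1 * bB lam p.1 p.2 +
          cB lam p.1 p.2 * (β p.2 - bB lam p.1 p.2)) *
        ((GLcard F (lam p.1 p.2) : ℂ) * (G (β p.1 - cB lam p.1 p.2) (lam p.1 p.2) : ℂ) *
          (G (β p.2 - bB lam p.1 p.2) (lam p.1 p.2) : ℂ)) := by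
      intro p hp
      have h1 := bB_le P hN β lam hlam _ _ (hDm p hp)
      have h2 := cB_le P hN β lam hlam _ _ (hDm p hp)
      unfold wB
      rw [bB_if, cB_if, Nat.cast_mul, WrecB_final _ hq G hG1 hG2 _ _ _ _ h2 (by omega),
        Nat.cast_pow, pow_add, mul_assoc, mul_assoc]
      simp only [GLcard, mul_assoc]
    rw [Finset.prod_congr rfl hw, Finset.prod_mul_distrib, Finset.prod_pow_eq_pow_sum]
    congr 1
    rw [eq_div_iff (pow_ne_zero _ hq0), ← pow_add]
    congr 1
    rw [bCrs_eq P hN, bDimL_eq P hN, bDimR_eq P hN, ← Finset.sum_add_distrib,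
      ← Finset.sum_add_distrib]
    apply Finset.sum_congr rfl
    intro p hp
    have h1 := bB_le P hN β lam hlam _ _ (hDm p hp)
    obtain ⟨d, hd⟩ := Nat.exists_eq_add_of_le (show bB lam p.1 p.2 ≤ β p.2 by omega)
    rw [hd, Nat.add_sub_cancel_left]
    ring
  · unfold chi
    have : ∀ Z : Matrix (Fin N) (Fin N) F,
        ψ (∑ r, ∑ s, Z r s * ((1 : Matrix (Fin N) (Fin N) F) - 1) r s) = 1 := by
      intro Z
      simp [hψ0]
    simp only [this]
    rw [finsum_mem_eq_finite_toFinset_sum _ (Set.toFinite _), Finset.sum_const, nsmul_eq_mul,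
      mul_one, Set.ncard_eq_toFinset_card _ (Set.toFinite _)]

end
end

section
/- Let 0 ≤ k ≤ n. Then Σ_{A ⊆ {1,…,n}, |A| = k} q^{wt(A)} · ∏_{i=1}^{k}(q^i − 1) = q^{k(k−1)/2} · ∏_{i=1}^{k}(q^{n−k+i} − 1), where wt(A) = #{(a,b) ∈ A × {1,…,n} : a < b}; equivalently, Σ_{A ⊆ {1,…,n}, |A| = k} q^{wt(A)} = q^{k(k−1)/2} · [n choose k]_q, as an identity of polynomials in an indeterminate q (equivalently, for every element q of a commutative ring). -/
lemma aux_wt (n : ℕ) (A : Finset ℕ) :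
    ((A ×ˢ Finset.range n).filter (fun p => p.1 < p.2)).card = ∑ a ∈ A, (n - 1 - a) := by
  rw [Finset.card_filter, Finset.sum_product]
  refine Finset.sum_congr rfl fun a _ => ?_
  rw [← Finset.card_filter]
  have : (Finset.range n).filter (fun b => a < b) = Finset.Ioo a n := by
    ext b; simp; tauto
  rw [this, Nat.card_Ioo]; omega

lemma aux_shift (n : ℕ) (A : Finset ℕ) (h : A ⊆ Finset.range n) :
    ∑ a ∈ A, (n + 1 - 1 - a) = ∑ a ∈ A, (n - 1 - a) + A.card := by
  rw [Finset.card_eq_sum_ones, ← Finset.sum_add_distrib]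
  refine Finset.sum_congr rfl fun a ha => ?_
  have := Finset.mem_range.1 (h ha)
  omega

lemma aux_rec {R : Type*} [CommRing R] (q : R) (n k : ℕ) :
    ∑ A ∈ Finset.powersetCard (k + 1) (Finset.range (n + 1)), q ^ (∑ a ∈ A, (n + 1 - 1 - a)) =
    q ^ (k + 1) * ∑ A ∈ Finset.powersetCard (k + 1) (Finset.range n), q ^ (∑ a ∈ A, (n - 1 - a)) +
    q ^ k * ∑ A ∈ Finset.powersetCard k (Finset.range n), q ^ (∑ a ∈ A, (n - 1 - a)) := by
  have hn : ∀ m, ∀ A ∈ Finset.powersetCard m (Finset.range n), n ∉ A := by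
    intro m A hA hnA
    simpa using (Finset.mem_powersetCard.1 hA).1 hnA
  rw [Finset.range_add_one, Finset.powersetCard_succ_insert (by simp), Finset.sum_union,
    Finset.sum_image, Finset.mul_sum, Finset.mul_sum]
  · congr 1
    · refine Finset.sum_congr rfl fun A hA => ?_
      obtain ⟨h1, h2⟩ := Finset.mem_powersetCard.1 hA
      rw [aux_shift n A h1, h2, pow_add, mul_comm]
    · refine Finset.sum_congr rfl fun A hA => ?_
      obtain ⟨h1, h2⟩ := Finset.mem_powersetCard.1 hA
      rw [Finset.sum_insert (hn _ A hA), aux_shift n A h1, h2]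
      simp [pow_add, mul_comm]
  · intro A hA B hB h
    have h' : insert n A = insert n B := h
    rw [← Finset.erase_insert (hn _ A hA), h', Finset.erase_insert (hn _ B hB)]
  · rw [Finset.disjoint_left]
    intro A hA hA'
    obtain ⟨B, _, rfl⟩ := Finset.mem_image.1 hA'
    exact hn _ _ hA (Finset.mem_insert_self _ _)

lemma aux_main {R : Type*} [CommRing R] (q : R) (n : ℕ) : ∀ k : ℕ,
    (∑ A ∈ Finset.powersetCard k (Finset.range n), q ^ (∑ a ∈ A, (n - 1 - a))) *
      ∏ i ∈ Finset.range k, (q ^ (i + 1) - 1) =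
    q ^ (k.choose 2) * ∏ j ∈ Finset.range k, (q ^ (n - j) - 1) := by
  induction n with
  | zero =>
    intro k
    cases k with
    | zero => simp
    | succ k =>
      rw [Finset.powersetCard_eq_empty.2 (by simp), Finset.prod_range_succ']
      simp [Finset.prod_range_succ']
  | succ n ih =>
    intro k
    cases k with
    | zero => simp
    | succ k =>
      have h1 := ih (k + 1)
      have h0 := ih k
      rw [aux_rec]
      have hc : (k + 1).choose 2 = k.choose 2 + k := by
        rw [Nat.choose_succ_succ' k 1, Nat.choose_one_right, add_comm]
      rw [Finset.prod_range_succ' (fun j => q ^ (n + 1 - j) - 1)]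
      simp only [Nat.add_sub_add_right, Nat.sub_zero]
      rw [Finset.prod_range_succ (fun j => q ^ (n - j) - 1)] at h1
      rw [add_mul, mul_assoc, h1, Finset.prod_range_succ, hc]
      have key : (∏ j ∈ Finset.range k, (q ^ (n - j) - 1)) *
          (q ^ (k + 1) * (q ^ (n - k) - 1) + q ^ (k + 1) - 1) =
          (∏ j ∈ Finset.range k, (q ^ (n - j) - 1)) * (q ^ (n + 1) - 1) := by
        by_cases hkn : k ≤ n
        · obtain ⟨d, rfl⟩ := Nat.exists_eq_add_of_le hkn
          rw [Nat.add_sub_cancel_left]; ring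
        · rw [Finset.prod_eq_zero (i := n) (by simp; omega) (by simp)]; simp
      rw [pow_add q (k.choose 2) k]
      linear_combination q ^ k * (q ^ (k + 1) - 1) * h0 + q ^ (k.choose 2) * q ^ k * key


/-- for `0 ≤ k ≤ n`,
`(Σ_{A ⊆ {1,…,n}, |A| = k} q^{wt(A)}) · ∏_{i=1}^{k}(q^i − 1)
  = q^{k(k−1)/2} · ∏_{i=1}^{k}(q^{n−k+i} − 1)`,
where `wt(A) = #{(a,b) ∈ A × {1,…,n} : a < b}`, for every element `q` of a commutative
ring; equivalently `Σ_{|A|=k} q^{wt(A)} = q^{k(k−1)/2} [n choose k]_q`. -/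
theorem stmt_19 (R : Type*) [CommRing R] (q : R) (n k : ℕ) (hk : k ≤ n) :
    (∑ A ∈ Finset.powersetCard k (Finset.range n),
        q ^ ((A ×ˢ Finset.range n).filter (fun p => p.1 < p.2)).card) *
      ∏ i ∈ Finset.range k, (q ^ (i + 1) - 1) =
    q ^ (k * (k - 1) / 2) * ∏ i ∈ Finset.range k, (q ^ (n - k + i + 1) - 1) := by
  simp only [aux_wt]
  rw [aux_main, Nat.choose_two_right]
  congr 1
  rw [← Finset.prod_range_reflect]
  refine Finset.prod_congr rfl fun i hi => ?_
  have := Finset.mem_range.1 hi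
  congr 2
  omega
end
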